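/- Let k be an integer, f : H_S → ℂ, and a : ℚ^{n+2} → ℂ a function vanishing outside L₀^# ∩ cl(P_S), such that for every z ∈ H_S the family λ ↦ a(λ)·e^{2πi(λ,z)₀} (λ ∈ L₀^# ∩ cl(P_S)) is summable with sum f(z), and such that f(M⟨z⟩) = j(M,z)^k·f(z) for all M ∈ Γ̃_S and z ∈ H_S (i.e. f is a modular form of weight k with Fourier coefficients a). Then the following are equivalent: (A) for every λ = (l,μ,m) ∈ (L₀^# ∩ cl(P_S)) \ {0}: a(λ) = Σ_{d | gcd(S₀λ), d>0} d^{k−1}·a(lm/d², μ/d, 1) (the Maaß condition); (B) for every prime p, every integer t ≥ 1, and every λ = (l,μ,p^t·m) ∈ L₀^# ∩ cl(P_S) with m ∈ ℤ and p ∤ m: a(l,μ,p^t·m) = a(p^t·l, μ, m) + p^{k−1}·a(l/p, μ/p, p^{t−1}·m) (the local Maaß condition). -/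

import Mathlib

open Matrix Complex

namespace OEis

/-- Extension of an even Gram matrix by a hyperbolic plane:
`[[0,0,1],[0,A,0],[1,0,0]]`. -/
def hyp {m : ℕ} (A : Matrix (Fin m) (Fin m) ℤ) :
    Matrix (Fin (m + 2)) (Fin (m + 2)) ℤ := fun i j =>
  if hi0 : (i : ℕ) = 0 then (if (j : ℕ) = m + 1 then 1 else 0)
  else if him : (i : ℕ) = m + 1 then (if (j : ℕ) = 0 then 1 else 0)
  else if hj0 : (j : ℕ) = 0 then 0
  else if hjm : (j : ℕ) = m + 1 then 0
  else A ⟨(i : ℕ) - 1, by have := i.isLt; omega⟩ ⟨(j : ℕ) - 1, by have := j.isLt; omega⟩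

variable (n : ℕ) (S : Matrix (Fin n) (Fin n) ℤ)

/-- `S₀ = [[0,0,1],[0,-S,0],[1,0,0]]`. -/
def MatS0 : Matrix (Fin (n + 2)) (Fin (n + 2)) ℤ := hyp (-S)

/-- `S₁ = [[0,0,1],[0,S₀,0],[1,0,0]]`. -/
def MatS1 : Matrix (Fin (n + 4)) (Fin (n + 4)) ℤ := hyp (MatS0 n S)

/-- Bilinear form `uᵀ A v` over a field `K`. -/
def bilin {m : ℕ} (K : Type) [Field K] (A : Matrix (Fin m) (Fin m) ℤ)
    (u v : Fin m → K) : K :=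
  u ⬝ᵥ (A.map (Int.cast : ℤ → K)).mulVec v

/-- Quadratic form `Q_A(v) = vᵀAv/2` over a field `K`. -/
def quadF {m : ℕ} (K : Type) [Field K] (A : Matrix (Fin m) (Fin m) ℤ)
    (v : Fin m → K) : K := bilin K A v v / 2

/-- First component of a vector. -/
def vfirst {m : ℕ} {K : Type} (g : Fin (m + 2) → K) : K := g ⟨0, by omega⟩

/-- Last component of a vector. -/
def vlast {m : ℕ} {K : Type} (g : Fin (m + 2) → K) : K := g ⟨m + 1, by omega⟩

/-- Middle components of a vector. -/
def vmid {m : ℕ} {K : Type} (g : Fin (m + 2) → K) : Fin m → K :=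
  fun i => g ⟨(i : ℕ) + 1, by have := i.isLt; omega⟩

/-- gcd of the entries of a rational vector (via numerators). -/
def ratGcd {m : ℕ} (v : Fin m → ℚ) : ℕ :=
  Finset.gcd Finset.univ fun i => (v i).num.natAbs

/-- `v` has integral entries. -/
def inLat {m : ℕ} (v : Fin m → ℚ) : Prop := ∀ i, ∃ z : ℤ, v i = (z : ℚ)

/-- `g ∈ ℤ^m + c`. -/
def inLatShift {m : ℕ} (c g : Fin m → ℚ) : Prop := ∀ i, ∃ z : ℤ, g i - c i = (z : ℚ)

/-- Membership in the dual lattice `A⁻¹ℤ^m`, i.e. `Av` is integral. -/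
def inDual {m : ℕ} (A : Matrix (Fin m) (Fin m) ℤ) (v : Fin m → ℚ) : Prop :=
  ∀ i, ∃ z : ℤ, ((A.map (Int.cast : ℤ → ℚ)).mulVec v) i = (z : ℚ)

/-- The positive cone `P_S`. -/
def PosCone : Set (Fin (n + 2) → ℝ) :=
  {y | 0 < quadF ℝ (MatS0 n S) y ∧ 0 < y ⟨0, by omega⟩}

/-- The tube domain `H_S`. -/
def HS : Set (Fin (n + 2) → ℂ) :=
  {z | (fun i => (z i).im) ∈ PosCone n S}

/-- Automorphy factor attached to a vector:
`j(g,z) = -γ Q₀(z) + (d,z)₀ + δ` for `g = (δ,dᵀ,γ)ᵀ`. -/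
noncomputable def jay (g : Fin (n + 4) → ℚ) (z : Fin (n + 2) → ℂ) : ℂ :=
  -((vlast g : ℚ) : ℂ) * quadF ℂ (MatS0 n S) z
    + bilin ℂ (MatS0 n S) (fun i => ((vmid g i : ℚ) : ℂ)) z
    + ((vfirst g : ℚ) : ℂ)

/-- The index set of the Eisenstein series attached to a cusp `c`:
`{g ∈ L₁ + c : Q₁(g) = 0, gcd(S₁g) = 1}`. -/
def cuspSet (c : Fin (n + 4) → ℚ) : Set (Fin (n + 4) → ℚ) :=
  {g | inLatShift c g ∧ quadF ℚ (MatS1 n S) g = 0 ∧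
    ratGcd (((MatS1 n S).map (Int.cast : ℤ → ℚ)).mulVec g) = 1}

/-- The standard-form cusp vector `(1, 0, 𝔠ᵀ, 0, Q(𝔠))ᵀ`. -/
def stdCuspVec (fc : Fin n → ℚ) : Fin (n + 4) → ℚ := fun i =>
  if h0 : (i : ℕ) = 0 then 1
  else if h3 : (i : ℕ) = n + 3 then quadF ℚ S fc
  else if h12 : (i : ℕ) = 1 ∨ (i : ℕ) = n + 2 then 0
  else fc ⟨(i : ℕ) - 2, by have := i.isLt; omega⟩

/-- `c` is a standard-form cusp. -/
def IsStdCusp (c : Fin (n + 4) → ℚ) : Prop :=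
  ∃ fc : Fin n → ℚ, inDual S fc ∧ (∃ z : ℤ, quadF ℚ S fc = (z : ℚ)) ∧
    c = stdCuspVec n S fc

/-- The real orthogonal group of `A`. -/
def OSet {m : ℕ} (A : Matrix (Fin m) (Fin m) ℤ) : Set (Matrix (Fin m) (Fin m) ℝ) :=
  {M | Mᵀ * A.map (Int.cast : ℤ → ℝ) * M = A.map (Int.cast : ℤ → ℝ)}

/-- Connected component of the identity in the real orthogonal group. -/
def OPlus {m : ℕ} (A : Matrix (Fin m) (Fin m) ℤ) : Set (Matrix (Fin m) (Fin m) ℝ) :=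
  connectedComponentIn (OSet A) 1

/-- `Γ_S`: integral matrices in `O⁺(S₁;ℝ)`. -/
def GammaS : Set (Matrix (Fin (n + 4)) (Fin (n + 4)) ℝ) :=
  {M | M ∈ OPlus (MatS1 n S) ∧ ∀ i j, ∃ z : ℤ, M i j = (z : ℝ)}

/-- The discriminant kernel `Γ̃_S`. -/
def GammaTilde : Set (Matrix (Fin (n + 4)) (Fin (n + 4)) ℝ) :=
  {M | M ∈ GammaS n S ∧
    ∃ X : Matrix (Fin (n + 4)) (Fin (n + 4)) ℤ,
      M = 1 + (X * MatS1 n S).map (Int.cast : ℤ → ℝ)}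

/-- Automorphy factor of a matrix: `j(M,z) = -γ Q₀(z) + (d,z)₀ + δ`
where `(γ, dᵀS₀, δ)` is the bottom row of `M`. -/
noncomputable def jayM (M : Matrix (Fin (n + 4)) (Fin (n + 4)) ℝ)
    (z : Fin (n + 2) → ℂ) : ℂ :=
  -((M ⟨n + 3, by omega⟩ ⟨0, by omega⟩ : ℝ) : ℂ) * quadF ℂ (MatS0 n S) z
    + ∑ i : Fin (n + 2),
        ((M ⟨n + 3, by omega⟩ ⟨(i : ℕ) + 1, by have := i.isLt; omega⟩ : ℝ) : ℂ) * z i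
    + ((M ⟨n + 3, by omega⟩ ⟨n + 3, by omega⟩ : ℝ) : ℂ)

/-- The action `M⟨z⟩ = (-Q₀(z)·b + Kz + c')·j(M,z)⁻¹`. -/
noncomputable def actM (M : Matrix (Fin (n + 4)) (Fin (n + 4)) ℝ)
    (z : Fin (n + 2) → ℂ) : Fin (n + 2) → ℂ := fun i =>
  (-(quadF ℂ (MatS0 n S) z) *
      ((M ⟨(i : ℕ) + 1, by have := i.isLt; omega⟩ ⟨0, by omega⟩ : ℝ) : ℂ)
    + ∑ j : Fin (n + 2),
        ((M ⟨(i : ℕ) + 1, by have := i.isLt; omega⟩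
            ⟨(j : ℕ) + 1, by have := j.isLt; omega⟩ : ℝ) : ℂ) * z j
    + ((M ⟨(i : ℕ) + 1, by have := i.isLt; omega⟩ ⟨n + 3, by omega⟩ : ℝ) : ℂ))
  * (jayM n S M z)⁻¹

/-- The integral vector `(−Q₀(d)/γ, dᵀ, γ)ᵀ` built from `d` and `γ`. -/
def gExt (d : Fin (n + 2) → ℕ) (γ : ℕ) : Fin (n + 4) → ℚ := fun i =>
  if h0 : (i : ℕ) = 0 then -(quadF ℚ (MatS0 n S) fun j => (d j : ℚ)) / γ
  else if h3 : (i : ℕ) = n + 3 then (γ : ℚ)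
  else (d ⟨(i : ℕ) - 1, by have := i.isLt; omega⟩ : ℚ)

open scoped Classical in
/-- The Dirichlet coefficient `a(λ,γ)`. -/
noncomputable def aCoef (lam : Fin (n + 2) → ℚ) (γ : ℕ) : ℂ :=
  ∑ d ∈ Fintype.piFinset fun _ : Fin (n + 2) => Finset.range γ,
    if (∃ e : ℤ, quadF ℚ (MatS0 n S) (fun j => (d j : ℚ)) = (γ : ℚ) * e) ∧
        ratGcd (((MatS1 n S).map (Int.cast : ℤ → ℚ)).mulVec (gExt n S d γ)) = 1 then
      Complex.exp (2 * Real.pi * Complex.I *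
        ((bilin ℚ (MatS0 n S) lam (fun j => (d j : ℚ)) / γ : ℚ) : ℂ))
    else 0

/-- The convolution `b(λ,γ) = Σ_{δ∣γ} a(λ,δ)`. -/
noncomputable def bCoef (lam : Fin (n + 2) → ℚ) (γ : ℕ) : ℂ :=
  ∑ δ ∈ γ.divisors, aCoef n S lam δ

/-- The order/level of a rational vector: least `N ≥ 1` with `Nv` integral. -/
noncomputable def ordv {m : ℕ} (v : Fin m → ℚ) : ℕ :=
  sInf {N : ℕ | 0 < N ∧ ∀ i, ∃ z : ℤ, (N : ℚ) * v i = (z : ℚ)}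

/-- `S` is `p`-maximal. -/
def pMaximal (p : ℕ) : Prop :=
  ∀ v : Fin n → ℚ, inDual S v → (∃ z : ℤ, quadF ℚ S v = (z : ℚ)) → ¬ p ∣ ordv v

/-- The vector `(l, μᵀ, m)ᵀ ∈ ℚ^{n+2}`. -/
def asmVec (l : ℚ) (μ : Fin n → ℚ) (m : ℚ) : Fin (n + 2) → ℚ := fun i =>
  if h0 : (i : ℕ) = 0 then l
  else if h1 : (i : ℕ) = n + 1 then m
  else μ ⟨(i : ℕ) - 1, by have := i.isLt; omega⟩

open scoped Classical in
/-- The representation number `N(λ, p^ν, p^t)`. -/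
noncomputable def Ncount (lam : Fin (n + 2) → ℚ) (p νl ν t : ℕ) : ℕ :=
  ((Fintype.piFinset fun _ : Fin n => Finset.range (p ^ ν)).filter fun v =>
    (∃ e : ℤ, quadF ℚ S (fun i => (v i : ℚ)) = (p : ℚ) ^ (t : ℕ) * e) ∧
    (∃ e : ℤ, (p : ℚ) ^ ((νl : ℤ) - (t : ℤ)) * quadF ℚ S (fun i => (v i : ℚ))
        - bilin ℚ S (fun i => (v i : ℚ)) (vmid lam)
        + (p : ℚ) ^ ((t : ℤ) - (νl : ℤ)) * lam ⟨0, by omega⟩ * lam ⟨n + 1, by omega⟩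
      = (p : ℚ) ^ (ν : ℕ) * e)).card

/-- `N*(λ,p^ν) = Σ_{t=0}^{min(ν,ν_λ)} N(λ,p^ν,p^t)`. -/
noncomputable def Nstar (lam : Fin (n + 2) → ℚ) (p νl ν : ℕ) : ℕ :=
  ∑ t ∈ Finset.range (min ν νl + 1), Ncount n S lam p νl ν t

/-- Kloosterman sum `K(α,β;γ)` (with `β` allowed rational;
in all uses `β` is an integer). -/
noncomputable def kloos (α : ℤ) (β : ℚ) (γ : ℕ) : ℂ :=
  ∑ j ∈ Finset.range γ,
    if Nat.Coprime j γ then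
      Complex.exp (2 * Real.pi * Complex.I *
        ((((α : ℚ) * j + β * ((((j : ZMod γ)⁻¹).val : ℕ) : ℚ)) / γ : ℚ) : ℂ))
    else 0

/-- `q ≡ 0 (mod p^k)` in `ℤ_p`, for a rational `q`. -/
def pCong (p k : ℕ) (q : ℚ) : Prop :=
  q = 0 ∨ (k : ℤ) ≤ padicValRat p q

/-- The constant `c_{k,S}^• = (2π)^{2k-n/2}/(√(det S)·Γ(k)·Γ(k-n/2))`. -/
noncomputable def ckS (k : ℕ) : ℝ :=
  (2 * Real.pi) ^ ((2 * k : ℝ) - n / 2) /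
    (Real.sqrt ((S.det : ℤ) : ℝ) * Real.Gamma (k : ℝ) * Real.Gamma ((k : ℝ) - n / 2))

end OEis

namespace OEis

/-- A family of Fourier coefficients with distinct frequencies is determined by its (pointwise
convergent) Fourier series. -/
lemma eq_zero_of_hasSum_fourier {N : ℕ} {ι : Type*} (φ : ι → Fin N → ℤ)
    (hφ : Function.Injective φ) (c : ι → ℂ)
    (h : ∀ x : Fin N → ℝ,
      HasSum (fun i => c i * Complex.exp (2 * Real.pi * Complex.I * ∑ j, (φ i j : ℂ) * x j)) 0)
    (i : ι) : c i = 0 := by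
  have hE : ∀ (j : ι) (x : Fin N → ℝ),
      UnitAddTorus.mFourier (φ j) (fun l => (x l : UnitAddCircle))
        = Complex.exp (2 * Real.pi * Complex.I * ∑ l, (φ j l : ℂ) * x l) := by
    intro j x
    simp only [UnitAddTorus.mFourier, ContinuousMap.coe_mk, fourier_coe_apply]
    rw [← Complex.exp_sum, Finset.mul_sum]
    congr 1
    refine Finset.sum_congr rfl fun l _ => ?_
    push_cast
    ring
  have hc : Summable c := by
    have := (h 0).summable
    simpa using this
  have hsm : Summable fun j => c j • UnitAddTorus.mFourier (φ j) := by
    refine Summable.of_norm ?_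
    simpa only [norm_smul, UnitAddTorus.mFourier_norm, mul_one] using hc.norm
  have h0 : HasSum (fun j => c j • UnitAddTorus.mFourier (φ j)) 0 := by
    have hev : ∀ t, (∑' j, c j • UnitAddTorus.mFourier (φ j)) t = 0 := by
      intro t
      have h1 := (ContinuousMap.evalCLM ℂ t).hasSum hsm.hasSum
      obtain ⟨x, rfl⟩ : ∃ x : Fin N → ℝ, t = fun l => (x l : UnitAddCircle) := by
        choose x hx using fun l => QuotientAddGroup.mk_surjective (t l)
        exact ⟨x, funext fun l => (hx l).symm⟩
      refine h1.unique ?_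
      refine (h x).congr_fun fun j => ?_
      simp [hE]
    have := hsm.hasSum
    rwa [show (∑' j, c j • UnitAddTorus.mFourier (φ j)) = 0 from ContinuousMap.ext hev] at this
  have hL : HasSum (fun j => c j • UnitAddTorus.mFourierLp 2 (φ j)) 0 := by
    simpa using! (ContinuousMap.toLp (E := ℂ) 2
      (MeasureTheory.Measure.pi fun _ : Fin N => AddCircle.haarAddCircle (T := 1)) ℂ).hasSum h0
  classical
  have hin := (innerSL ℂ (UnitAddTorus.mFourierLp 2 (φ i))).hasSum hL
  rw [map_zero] at hin
  refine (hasSum_ite_eq i (c i)).unique (hin.congr_fun fun j => ?_)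
  have := (orthonormal_iff_ite.mp (UnitAddTorus.orthonormal_mFourier (d := Fin N))) (φ i) (φ j)
  simp only [map_smul, innerSL_apply_apply]
  rw [this]
  by_cases hij : j = i
  · simp [hij]
  · simp [hij, hφ.eq_iff, Ne.symm hij]

lemma fin_add_two_cases {m : ℕ} (i : Fin (m + 2)) :
    i = ⟨0, by omega⟩ ∨ i = ⟨m + 1, by omega⟩ ∨
      ∃ j : Fin m, i = ⟨(j : ℕ) + 1, by have := j.isLt; omega⟩ := by
  rcases i with ⟨i, hi⟩
  by_cases h0 : i = 0
  · exact Or.inl (Fin.ext h0)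
  by_cases h1 : i = m + 1
  · exact Or.inr (Or.inl (Fin.ext h1))
  · exact Or.inr (Or.inr ⟨⟨i - 1, by omega⟩, Fin.ext (by simp only; omega)⟩)

lemma fin_val_ne {m : ℕ} (i : Fin m) : (i : ℕ) ≠ m := i.isLt.ne

lemma sum_fin_add_two {m : ℕ} {R : Type*} [AddCommMonoid R] (f : Fin (m + 2) → R) :
    ∑ i, f i = f ⟨0, by omega⟩
      + ∑ i : Fin m, f ⟨(i : ℕ) + 1, by have := i.isLt; omega⟩ + f ⟨m + 1, by omega⟩ := by
  rw [Fin.sum_univ_succ, Fin.sum_univ_castSucc, ← add_assoc]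
  rfl

section Hyp

variable {m : ℕ} (A : Matrix (Fin m) (Fin m) ℤ) {K : Type} [Field K] (x y : Fin (m + 2) → K)

lemma hyp_mulVec_first :
    ((hyp A).map (Int.cast : ℤ → K)).mulVec x ⟨0, by omega⟩ = x ⟨m + 1, by omega⟩ := by
  rw [Matrix.mulVec, dotProduct, sum_fin_add_two]
  simp [hyp, fin_val_ne]

lemma hyp_mulVec_last :
    ((hyp A).map (Int.cast : ℤ → K)).mulVec x ⟨m + 1, by omega⟩ = x ⟨0, by omega⟩ := by
  rw [Matrix.mulVec, dotProduct, sum_fin_add_two]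
  simp [hyp]

lemma hyp_mulVec_mid (i : Fin m) :
    ((hyp A).map (Int.cast : ℤ → K)).mulVec x ⟨(i : ℕ) + 1, by have := i.isLt; omega⟩
      = (A.map (Int.cast : ℤ → K)).mulVec (vmid x) i := by
  rw [Matrix.mulVec, dotProduct, sum_fin_add_two]
  simp [hyp, fin_val_ne, Matrix.mulVec, dotProduct, vmid]

lemma bilin_hyp :
    bilin K (hyp A) x y = x ⟨0, by omega⟩ * y ⟨m + 1, by omega⟩
      + x ⟨m + 1, by omega⟩ * y ⟨0, by omega⟩ + bilin K A (vmid x) (vmid y) := by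
  rw [bilin, dotProduct, sum_fin_add_two, hyp_mulVec_first, hyp_mulVec_last]
  simp only [hyp_mulVec_mid]
  rw [bilin, dotProduct]
  simp only [vmid]
  ring

lemma hyp_isSymm {A : Matrix (Fin m) (Fin m) ℤ} (hA : A.IsSymm) : (hyp A).IsSymm := by
  ext i j
  rcases fin_add_two_cases i with rfl | rfl | ⟨i, rfl⟩ <;>
    rcases fin_add_two_cases j with rfl | rfl | ⟨j, rfl⟩ <;>
    simp [hyp, fin_val_ne, hA.apply]

lemma hyp_mulVec_injective
    (hA : ∀ v : Fin m → K, (A.map (Int.cast : ℤ → K)).mulVec v = 0 → v = 0)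
    (h : ((hyp A).map (Int.cast : ℤ → K)).mulVec x = 0) : x = 0 := by
  have hm : vmid x = 0 := hA _ (funext fun i => by
    rw [← hyp_mulVec_mid, h]; rfl)
  funext i
  rcases fin_add_two_cases i with rfl | rfl | ⟨i, rfl⟩
  · rw [← hyp_mulVec_last A x, h]; rfl
  · rw [← hyp_mulVec_first A x, h]; rfl
  · exact congrFun hm i

end Hyp

section Bilin

variable {m : ℕ} {K : Type} [Field K] (A : Matrix (Fin m) (Fin m) ℤ) (x y z : Fin m → K) (c : K)

lemma bilin_add_left : bilin K A (x + y) z = bilin K A x z + bilin K A y z := by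
  simp [bilin, add_dotProduct]

lemma bilin_add_right : bilin K A x (y + z) = bilin K A x y + bilin K A x z := by
  simp [bilin, mulVec_add, dotProduct_add]

lemma bilin_smul_left : bilin K A (c • x) y = c * bilin K A x y := by
  simp [bilin, smul_dotProduct]

lemma bilin_smul_right : bilin K A x (c • y) = c * bilin K A x y := by
  simp [bilin, mulVec_smul, dotProduct_smul]

lemma bilin_neg : bilin K (-A) x y = - bilin K A x y := by
  have : (-A).map (Int.cast : ℤ → K) = -(A.map Int.cast) := by ext; simp
  simp [bilin, this, neg_mulVec]

variable {A} in
lemma bilin_comm (hA : A.IsSymm) : bilin K A x y = bilin K A y x := by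
  rw [bilin, dotProduct_mulVec, ← mulVec_transpose, dotProduct_comm, bilin]
  congr 2
  ext i j
  simp [hA.apply]

end Bilin

section Eichler

variable {m : ℕ} (A : Matrix (Fin m) (Fin m) ℤ)

/-- The Eichler transvection attached to an isotropic vector `e` and a vector `w ⊥ e` with
`Q_A(w) = q`. -/
def eichler {K : Type} [Field K] (e w : Fin m → K) (q : K) (x : Fin m → K) : Fin m → K :=
  x + bilin K A e x • w - (bilin K A w x + q * bilin K A e x) • e

/-- The matrix `X` for which `1 + X * A` is the matrix of the Eichler transvection. -/
def eichlerX {R : Type} [CommRing R] (e w : Fin m → R) (q : R) : Matrix (Fin m) (Fin m) R :=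
  vecMulVec w e - vecMulVec e w - q • vecMulVec e e

variable {A}

lemma eichlerX_mulVec {K : Type} [Field K] (e w : Fin m → K) (q : K) (x : Fin m → K) :
    (1 + eichlerX e w q * A.map (Int.cast : ℤ → K)).mulVec x = eichler A e w q x := by
  have h : ∀ u v y : Fin m → K, (vecMulVec u v).mulVec y = (v ⬝ᵥ y) • u := by
    intro u v y
    ext i
    simp [vecMulVec, Matrix.mulVec, dotProduct, Finset.mul_sum, mul_comm, mul_left_comm]
  simp only [eichlerX, add_mulVec, one_mulVec, ← mulVec_mulVec, sub_mulVec, smul_mulVec, h,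
    eichler, bilin]
  module

section Field

variable {K : Type} [Field K] {e w : Fin m → K} {q : K}

lemma bilin_eichler (hA : A.IsSymm) (hee : bilin K A e e = 0) (hew : bilin K A e w = 0)
    (hww : bilin K A w w = 2 * q) (x y : Fin m → K) :
    bilin K A (eichler A e w q x) (eichler A e w q y) = bilin K A x y := by
  have hwe := bilin_comm w e hA
  simp only [eichler, sub_eq_add_neg, ← neg_smul, bilin_add_left, bilin_add_right,
    bilin_smul_left, bilin_smul_right, hee, hew, hww, hwe, bilin_comm x w hA, bilin_comm x e hA]
  ring

lemma eichler_neg_eichler (hA : A.IsSymm) (hee : bilin K A e e = 0) (hew : bilin K A e w = 0)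
    (hww : bilin K A w w = 2 * q) (x : Fin m → K) :
    eichler A e (-w) q (eichler A e w q x) = x := by
  have hwe := bilin_comm w e hA
  have hneg : ∀ y, bilin K A (-w) y = - bilin K A w y := fun y => by simp [bilin]
  have h1 : bilin K A e (eichler A e w q x) = bilin K A e x := by
    simp only [eichler, sub_eq_add_neg, ← neg_smul, bilin_add_right, bilin_smul_right, hee, hew]
    ring
  have h2 : bilin K A w (eichler A e w q x) = bilin K A w x + 2 * q * bilin K A e x := by
    simp only [eichler, sub_eq_add_neg, ← neg_smul, bilin_add_right, bilin_smul_right, hwe, hew,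
      hww]
    ring
  rw [eichler, h1, hneg, h2, eichler]
  module

/-- The Eichler transvection as a bijection. -/
def eichlerEquiv (hA : A.IsSymm) (hee : bilin K A e e = 0) (hew : bilin K A e w = 0)
    (hww : bilin K A w w = 2 * q) : (Fin m → K) ≃ (Fin m → K) where
  toFun := eichler A e w q
  invFun := eichler A e (-w) q
  left_inv := eichler_neg_eichler hA hee hew hww
  right_inv x := by
    have hneg : ∀ y, bilin K A y (-w) = - bilin K A y w := fun y => by simp [bilin, mulVec_neg]
    have := eichler_neg_eichler (e := e) (w := -w) (q := q) hA hee (by simp [hneg, hew])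
      (by simpa [bilin, mulVec_neg] using hww) x
    rwa [neg_neg] at this

end Field

lemma map_eichlerX {e w : Fin m → ℤ} {q : ℤ} (K : Type) [Field K] :
    (eichlerX e w q * A).map (Int.cast : ℤ → K)
      = eichlerX (fun i => (e i : K)) (fun i => (w i : K)) (q : K) * A.map Int.cast := by
  have := Matrix.map_mul (L := eichlerX e w q) (M := A) (f := Int.castRingHom K)
  simp only [Int.coe_castRingHom] at this
  refine this.trans ?_
  congr 1
  ext i j
  simp [eichlerX, vecMulVec]

lemma bilin_intCast (K : Type) [Field K] (u v : Fin m → ℤ) :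
    bilin K A (fun i => (u i : K)) (fun i => (v i : K)) = ((u ⬝ᵥ A.mulVec v : ℤ) : K) := by
  simp [bilin, dotProduct, Matrix.mulVec]

lemma mem_OSet_iff {M : Matrix (Fin m) (Fin m) ℝ} :
    M ∈ OSet A ↔ ∀ x y, bilin ℝ A (M.mulVec x) (M.mulVec y) = bilin ℝ A x y := by
  have key : ∀ x y, bilin ℝ A (M.mulVec x) (M.mulVec y)
      = x ⬝ᵥ (Mᵀ * A.map (Int.cast : ℤ → ℝ) * M).mulVec y := by
    intro x y
    rw [bilin, ← mulVec_mulVec, ← mulVec_mulVec, dotProduct_mulVec x, vecMul_transpose]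
  simp only [key]
  refine ⟨fun h x y => by rw [show _ = _ from h, bilin], fun h => ?_⟩
  change _ = _
  ext i j
  have := h (Pi.single i 1) (Pi.single j 1)
  rw [bilin] at this
  rw [single_one_dotProduct, mulVec_single_one, single_one_dotProduct, mulVec_single_one] at this
  exact this

lemma mem_OPlus_of_path (γ : ℝ → Matrix (Fin m) (Fin m) ℝ) (hc : Continuous γ) (h0 : γ 0 = 1)
    (hO : ∀ s, γ s ∈ OSet A) : γ 1 ∈ OPlus A := by
  refine (isPreconnected_range hc).subset_connectedComponentIn ⟨0, h0⟩ ?_ ⟨1, rfl⟩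
  rintro _ ⟨s, rfl⟩
  exact hO s

end Eichler

section Bordered

variable {m : ℕ}

/-- The block matrix with border entries `a`, central block `K`, and zeros elsewhere. -/
def bord {R : Type} [Zero R] (a : R) (K : Matrix (Fin m) (Fin m) R) :
    Matrix (Fin (m + 2)) (Fin (m + 2)) R := fun i j =>
  if hi0 : (i : ℕ) = 0 then (if (j : ℕ) = 0 then a else 0)
  else if him : (i : ℕ) = m + 1 then (if (j : ℕ) = m + 1 then a else 0)
  else if hj0 : (j : ℕ) = 0 then 0
  else if hjm : (j : ℕ) = m + 1 then 0
  else K ⟨(i : ℕ) - 1, by have := i.isLt; omega⟩ ⟨(j : ℕ) - 1, by have := j.isLt; omega⟩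

lemma bord_one {R : Type} [Zero R] [One R] : bord (1 : R) (1 : Matrix (Fin m) (Fin m) R) = 1 := by
  ext i j
  rcases fin_add_two_cases i with rfl | rfl | ⟨i, rfl⟩ <;>
    rcases fin_add_two_cases j with rfl | rfl | ⟨j, rfl⟩ <;>
    simp [bord, fin_val_ne, (fin_val_ne _).symm, Matrix.one_apply, Fin.ext_iff]

lemma continuous_bord : Continuous (bord (1 : ℝ) : Matrix (Fin m) (Fin m) ℝ → _) := by
  refine continuous_matrix fun i j => ?_
  unfold bord
  split_ifs <;> fun_prop

lemma bord_mem_OSet {A : Matrix (Fin m) (Fin m) ℤ} {K : Matrix (Fin m) (Fin m) ℝ}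
    (hK : K ∈ OSet A) : bord 1 K ∈ OSet (hyp A) := by
  have h0 : ∀ x, (bord 1 K).mulVec x ⟨0, by omega⟩ = x ⟨0, by omega⟩ := fun x => by
    rw [Matrix.mulVec, dotProduct, sum_fin_add_two]
    simp [bord]
  have h1 : ∀ x, (bord 1 K).mulVec x ⟨m + 1, by omega⟩ = x ⟨m + 1, by omega⟩ := fun x => by
    rw [Matrix.mulVec, dotProduct, sum_fin_add_two]
    simp [bord, fin_val_ne]
  have h2 : ∀ x, vmid ((bord 1 K).mulVec x) = K.mulVec (vmid x) := fun x => by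
    ext i
    rw [vmid, Matrix.mulVec, dotProduct, sum_fin_add_two]
    simp [bord, fin_val_ne, Matrix.mulVec, dotProduct, vmid]
  rw [mem_OSet_iff] at hK ⊢
  intro x y
  simp only [bilin_hyp, h0, h1, h2, hK]

lemma bord_one_add_mul (X A : Matrix (Fin m) (Fin m) ℤ) :
    bord 1 (1 + (X * A).map (Int.cast : ℤ → ℝ))
      = 1 + (bord 0 X * hyp A).map (Int.cast : ℤ → ℝ) := by
  ext i j
  rw [Matrix.add_apply, Matrix.map_apply, Matrix.mul_apply, sum_fin_add_two]
  rcases fin_add_two_cases i with rfl | rfl | ⟨i, rfl⟩ <;>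
    rcases fin_add_two_cases j with rfl | rfl | ⟨j, rfl⟩ <;>
    simp [bord, hyp, fin_val_ne, (fin_val_ne _).symm, Matrix.one_apply, Fin.ext_iff,
      Matrix.mul_apply]

end Bordered

section Modular

variable {n : ℕ} {S : Matrix (Fin n) (Fin n) ℤ} {e w : Fin (n + 2) → ℤ} {q : ℤ}

lemma MatS0_isSymm (hS : S.IsSymm) : (MatS0 n S).IsSymm :=
  hyp_isSymm (by rw [Matrix.IsSymm, transpose_neg, hS])

lemma bord_eichler_mem_GammaTilde (hS : S.IsSymm) (hee : e ⬝ᵥ (MatS0 n S).mulVec e = 0)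
    (hew : e ⬝ᵥ (MatS0 n S).mulVec w = 0) (hww : w ⬝ᵥ (MatS0 n S).mulVec w = 2 * q) :
    bord 1 (1 + (eichlerX e w q * MatS0 n S).map (Int.cast : ℤ → ℝ)) ∈ GammaTilde n S := by
  have hX := bord_one_add_mul (eichlerX e w q) (MatS0 n S)
  refine ⟨⟨?_, ?_⟩, bord 0 (eichlerX e w q), hX⟩
  · have := mem_OPlus_of_path (A := MatS1 n S) (fun s : ℝ => bord 1 (1 +
      eichlerX (fun i => (e i : ℝ)) (s • fun i => (w i : ℝ)) (s ^ 2 * q)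
        * (MatS0 n S).map (Int.cast : ℤ → ℝ))) ?_ ?_ ?_
    · simpa [map_eichlerX] using this
    · refine continuous_bord.comp ?_
      unfold eichlerX
      refine continuous_const.add (Continuous.matrix_mul ?_ continuous_const)
      refine continuous_matrix fun i j => ?_
      simp only [vecMulVec, Matrix.sub_apply, Matrix.smul_apply, Matrix.of_apply, Pi.smul_apply,
        smul_eq_mul]
      fun_prop
    · have : eichlerX (fun i => (e i : ℝ)) 0 0 = 0 := by simp [eichlerX]
      simp [this, bord_one]
    · intro s
      refine bord_mem_OSet (mem_OSet_iff.2 fun x y => ?_)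
      rw [eichlerX_mulVec, eichlerX_mulVec, bilin_eichler (MatS0_isSymm hS)]
      · rw [bilin_intCast, hee, Int.cast_zero]
      · rw [bilin_smul_right, bilin_intCast, hew, Int.cast_zero, mul_zero]
      · rw [bilin_smul_left, bilin_smul_right, bilin_intCast, hww]
        push_cast
        ring
  · intro i j
    rw [hX]
    exact ⟨(1 + bord 0 (eichlerX e w q) * hyp (MatS0 n S)) i j, by
      simp [Matrix.add_apply, Matrix.one_apply, apply_ite (Int.cast : ℤ → ℝ)]⟩

lemma jayM_bord (K : Matrix (Fin (n + 2)) (Fin (n + 2)) ℝ) (z : Fin (n + 2) → ℂ) :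
    jayM n S (bord 1 K) z = 1 := by
  simp [jayM, bord, fin_val_ne]

lemma actM_bord (K : Matrix (Fin (n + 2)) (Fin (n + 2)) ℝ) (z : Fin (n + 2) → ℂ) :
    actM n S (bord 1 K) z = (K.map ((↑) : ℝ → ℂ)).mulVec z := by
  ext i
  rw [actM, jayM_bord]
  simp [bord, fin_val_ne, Matrix.mulVec, dotProduct]

lemma actM_eichler (z : Fin (n + 2) → ℂ) :
    actM n S (bord 1 (1 + (eichlerX e w q * MatS0 n S).map (Int.cast : ℤ → ℝ))) z
      = eichler (MatS0 n S) (fun i => (e i : ℂ)) (fun i => (w i : ℂ)) (q : ℂ) z := by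
  rw [actM_bord, ← eichlerX_mulVec, ← map_eichlerX]
  congr 1
  ext i j
  simp [Matrix.one_apply, apply_ite ((↑) : ℝ → ℂ)]

lemma bilin_ratCast {m : ℕ} (A : Matrix (Fin m) (Fin m) ℤ) (u v : Fin m → ℚ) :
    ((bilin ℚ A u v : ℚ) : ℂ) = bilin ℂ A (fun i => (u i : ℂ)) (fun i => (v i : ℂ)) := by
  simp [bilin, dotProduct, Matrix.mulVec]

lemma eichler_ratCast {m : ℕ} (A : Matrix (Fin m) (Fin m) ℤ) (e w : Fin m → ℤ) (q : ℤ)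
    (x : Fin m → ℚ) :
    (fun i => ((eichler A (fun i => (e i : ℚ)) (fun i => (w i : ℚ)) (q : ℚ) x i : ℚ) : ℂ))
      = eichler A (fun i => (e i : ℂ)) (fun i => (w i : ℂ)) (q : ℂ) (fun i => (x i : ℂ)) := by
  ext i
  simp [eichler, bilin_ratCast]

lemma bilin_im {m : ℕ} (A : Matrix (Fin m) (Fin m) ℤ) (e : Fin m → ℤ) (z : Fin m → ℂ) :
    (bilin ℂ A (fun i => (e i : ℂ)) z).im = bilin ℝ A (fun i => (e i : ℝ)) (fun i => (z i).im) := by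
  simp [bilin, dotProduct, Matrix.mulVec]

lemma eichler_im {m : ℕ} (A : Matrix (Fin m) (Fin m) ℤ) (e w : Fin m → ℤ) (q : ℤ)
    (z : Fin m → ℂ) :
    (fun i => (eichler A (fun i => (e i : ℂ)) (fun i => (w i : ℂ)) (q : ℂ) z i).im)
      = eichler A (fun i => (e i : ℝ)) (fun i => (w i : ℝ)) (q : ℝ) (fun i => (z i).im) := by
  ext i
  simp [eichler, bilin_im]

lemma inDual_eichler {m : ℕ} {A : Matrix (Fin m) (Fin m) ℤ} {e w : Fin m → ℤ} {q : ℤ}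
    {x : Fin m → ℚ} (hx : inDual A x) :
    inDual A (eichler A (fun i => (e i : ℚ)) (fun i => (w i : ℚ)) (q : ℚ) x) := by
  choose κ hκ using hx
  have hb : ∀ u : Fin m → ℤ, bilin ℚ A (fun i => (u i : ℚ)) x = ((u ⬝ᵥ κ : ℤ) : ℚ) := fun u => by
    simp [bilin, dotProduct, hκ]
  have hu : ∀ u : Fin m → ℤ, (A.map (Int.cast : ℤ → ℚ)).mulVec (fun i => (u i : ℚ))
      = fun i => ((A.mulVec u i : ℤ) : ℚ) := fun u => by
    ext i
    simp [dotProduct, Matrix.mulVec]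
  intro i
  refine ⟨κ i + (e ⬝ᵥ κ) * A.mulVec w i - (w ⬝ᵥ κ + q * (e ⬝ᵥ κ)) * A.mulVec e i, ?_⟩
  rw [eichler, mulVec_sub, mulVec_add, mulVec_smul, mulVec_smul, hu, hu, hb, hb]
  simp [hκ]

variable {k : ℤ} {f : (Fin (n + 2) → ℂ) → ℂ} {a : (Fin (n + 2) → ℚ) → ℂ}

/-- Invariance of the Fourier coefficients of a modular form under Eichler transvections. -/
lemma coeff_eichler (hS : S.IsSymm)
    (hnd : ∀ x : Fin (n + 2) → ℚ, ((MatS0 n S).map (Int.cast : ℤ → ℚ)).mulVec x = 0 → x = 0)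
    (hvan : ∀ lam : Fin (n + 2) → ℚ,
      ¬(inDual (MatS0 n S) lam ∧
          (fun i => ((lam i : ℚ) : ℝ)) ∈ closure (PosCone n S)) → a lam = 0)
    (hsum : ∀ z ∈ HS n S,
      HasSum (fun lam : {lam : Fin (n + 2) → ℚ //
          inDual (MatS0 n S) lam ∧
            (fun i => ((lam i : ℚ) : ℝ)) ∈ closure (PosCone n S)} =>
        a lam.1 * Complex.exp (2 * Real.pi * Complex.I *
          bilin ℂ (MatS0 n S) (fun i => ((lam.1 i : ℚ) : ℂ)) z)) (f z))
    (hmod : ∀ M ∈ GammaTilde n S, ∀ z ∈ HS n S,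
      f (actM n S M z) = (jayM n S M z) ^ k * f z)
    (hee : e ⬝ᵥ (MatS0 n S).mulVec e = 0)
    (hew : e ⬝ᵥ (MatS0 n S).mulVec w = 0) (hww : w ⬝ᵥ (MatS0 n S).mulVec w = 2 * q)
    (hP : ∀ y ∈ PosCone n S, eichler (MatS0 n S) (fun i => (e i : ℝ)) (fun i => (w i : ℝ)) (q : ℝ) y
      ∈ PosCone n S)
    {y : Fin (n + 2) → ℝ} (hy : y ∈ PosCone n S)
    {lam : Fin (n + 2) → ℚ} (hlam : inDual (MatS0 n S) lam) :
    a (eichler (MatS0 n S) (fun i => (e i : ℚ)) (fun i => (w i : ℚ)) (q : ℚ) lam) = a lam := by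
  have hA := MatS0_isSymm hS
  set A := MatS0 n S with hAdef
  have cee : ∀ (K : Type) [Field K], bilin K A (fun i => (e i : K)) (fun i => (e i : K)) = 0 :=
    fun K _ => by rw [bilin_intCast, hee, Int.cast_zero]
  have cew : ∀ (K : Type) [Field K], bilin K A (fun i => (e i : K)) (fun i => (w i : K)) = 0 :=
    fun K _ => by rw [bilin_intCast, hew, Int.cast_zero]
  have cww : ∀ (K : Type) [Field K],
      bilin K A (fun i => (w i : K)) (fun i => (w i : K)) = 2 * (q : K) :=
    fun K _ => by rw [bilin_intCast, hww]; push_cast; rfl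
  set E : (Fin (n + 2) → ℚ) → (Fin (n + 2) → ℂ) → ℂ := fun l z =>
    Complex.exp (2 * Real.pi * Complex.I * bilin ℂ A (fun i => ((l i : ℚ) : ℂ)) z) with hE
  set T := eichlerEquiv (K := ℚ) hA (cee ℚ) (cew ℚ) (cww ℚ) with hT
  have hTapp : ∀ l, T l = eichler A (fun i => (e i : ℚ)) (fun i => (w i : ℚ)) (q : ℚ) l :=
    fun l => rfl
  have hdual : ∀ l, inDual A (T l) → inDual A l := by
    intro l hl
    have := inDual_eichler (e := e) (w := -w) (q := q) hl
    have h2 := T.symm_apply_apply l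
    rw [← h2]
    convert this using 1
    simp only [hT, eichlerEquiv, Equiv.symm, Equiv.coe_fn_mk]
    simp only [Pi.neg_apply, Int.cast_neg]
    rfl
  have hfull : ∀ z ∈ HS n S, HasSum (fun l => a l * E l z) (f z) := by
    intro z hz
    refine (hasSum_subtype_iff_of_support_subset (s := {lam : Fin (n + 2) → ℚ |
          inDual (MatS0 n S) lam ∧
            (fun i => ((lam i : ℚ) : ℝ)) ∈ closure (PosCone n S)}) ?_).1 (hsum z hz)
    intro l hl
    by_contra hcon
    exact hl (by simp [hvan l hcon])
  have hsum0 : ∀ z ∈ HS n S,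
      HasSum (fun l : {l // inDual A l} => (a (T l) - a l) * E l z) 0 := by
    intro z hz
    set z' := eichler A (fun i => (e i : ℂ)) (fun i => (w i : ℂ)) (q : ℂ) z with hz'
    have hz'H : z' ∈ HS n S := by
      have := hP _ hz
      rw [← eichler_im] at this
      exact this
    have hf : f z' = f z := by
      have := hmod _ (bord_eichler_mem_GammaTilde hS hee hew hww) z hz
      rwa [actM_eichler, jayM_bord, _root_.one_zpow, one_mul] at this
    have h1 := T.hasSum_iff.2 (hfull z' hz'H)
    have hEE : ∀ l, E (T l) z' = E l z := by
      intro l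
      simp only [hE, hTapp, hz', eichler_ratCast]
      rw [bilin_eichler hA (cee ℂ) (cew ℂ) (cww ℂ)]
    have h2 := h1.sub (hfull z hz)
    rw [hf, sub_self] at h2
    refine (hasSum_subtype_iff_of_support_subset (f := fun l => (a (T l) - a l) * E l z)
      (s := {l | inDual A l}) ?_).2
      (h2.congr_fun fun l => ?_)
    · intro l hl
      by_contra hcon
      refine hl ?_
      simp only [hvan l fun h => hcon h.1, hvan (T l) fun h => hcon (hdual l h.1), sub_zero,
        zero_mul]
    · simp only [Function.comp, hEE]
      ring
  choose φ hφ using fun l : {l // inDual A l} => l.2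
  have hφinj : Function.Injective φ := by
    intro l l' h
    refine Subtype.ext (sub_eq_zero.1 (hnd _ ?_))
    ext i
    rw [mulVec_sub, Pi.sub_apply, hφ l i, hφ l' i, h, sub_self]
    rfl
  have key := eq_zero_of_hasSum_fourier φ hφinj
    (fun l => (a (T l) - a l) * E l (fun i => (y i : ℂ) * Complex.I)) (fun x => by
      have hz : (fun i => (x i : ℂ) + (y i : ℂ) * Complex.I) ∈ HS n S := by
        simpa [HS] using hy
      refine (hsum0 _ hz).congr_fun fun l => ?_
      simp only [hE]
      rw [mul_assoc, ← Complex.exp_add, ← mul_add]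
      congr 4
      have : (fun i => (x i : ℂ) + (y i : ℂ) * Complex.I)
        = (fun i => (y i : ℂ) * Complex.I) + fun i => (x i : ℂ) := by ext i; simp [add_comm]
      rw [this, bilin_add_right]
      congr 1
      rw [bilin_comm _ _ hA, bilin, dotProduct]
      refine Finset.sum_congr rfl fun i _ => ?_
      rw [mul_comm]
      congr 1
      have := congrArg ((↑) : ℚ → ℂ) (hφ l i)
      simpa [Matrix.mulVec, dotProduct] using this.symm)
    ⟨lam, hlam⟩
  rcases mul_eq_zero.1 key with h | h
  · exact sub_eq_zero.1 h
  · exact absurd h (Complex.exp_ne_zero _)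

end Modular

section Cone

variable {n : ℕ} {S : Matrix (Fin n) (Fin n) ℤ}

lemma bilin_MatS0 {K : Type} [Field K] (x y : Fin (n + 2) → K) :
    bilin K (MatS0 n S) x y = x ⟨0, by omega⟩ * y ⟨n + 1, by omega⟩
      + x ⟨n + 1, by omega⟩ * y ⟨0, by omega⟩ - bilin K S (vmid x) (vmid y) := by
  rw [MatS0, bilin_hyp, bilin_neg, sub_eq_add_neg]

lemma quadF_MatS0 {K : Type} [Field K] (h2 : (2 : K) ≠ 0) (x : Fin (n + 2) → K) :
    quadF K (MatS0 n S) x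
      = x ⟨0, by omega⟩ * x ⟨n + 1, by omega⟩ - bilin K S (vmid x) (vmid x) / 2 := by
  rw [quadF, bilin_MatS0]
  field_simp
  ring

lemma bilin_self_nonneg (hpos : ∀ v : Fin n → ℝ, v ≠ 0 → 0 < bilin ℝ S v v) (v : Fin n → ℝ) :
    0 ≤ bilin ℝ S v v := by
  by_cases h : v = 0
  · simp [h, bilin]
  · exact (hpos v h).le

lemma pos_last_of_mem_PosCone (hpos : ∀ v : Fin n → ℝ, v ≠ 0 → 0 < bilin ℝ S v v)
    {y : Fin (n + 2) → ℝ} (hy : y ∈ PosCone n S) : 0 < y ⟨n + 1, by omega⟩ := by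
  obtain ⟨h1, h2⟩ := hy
  rw [quadF_MatS0 two_ne_zero] at h1
  have := bilin_self_nonneg hpos (vmid y)
  exact pos_of_mul_pos_right (by linarith) h2.le

lemma mem_PosCone_of_pos_last (hpos : ∀ v : Fin n → ℝ, v ≠ 0 → 0 < bilin ℝ S v v)
    {y : Fin (n + 2) → ℝ} (h1 : 0 < quadF ℝ (MatS0 n S) y) (h2 : 0 < y ⟨n + 1, by omega⟩) :
    y ∈ PosCone n S := by
  refine ⟨h1, ?_⟩
  rw [quadF_MatS0 two_ne_zero] at h1
  have := bilin_self_nonneg hpos (vmid y)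
  exact pos_of_mul_pos_left (by linarith) h2.le

lemma continuous_quadF {m : ℕ} (A : Matrix (Fin m) (Fin m) ℤ) : Continuous (quadF ℝ A) := by
  unfold quadF bilin
  refine Continuous.div_const (Continuous.dotProduct continuous_id ?_) _
  exact Continuous.matrix_mulVec continuous_const continuous_id

lemma mem_closure_PosCone_iff (hpos : ∀ v : Fin n → ℝ, v ≠ 0 → 0 < bilin ℝ S v v)
    {y : Fin (n + 2) → ℝ} :
    y ∈ closure (PosCone n S) ↔
      bilin ℝ S (vmid y) (vmid y) / 2 ≤ y ⟨0, by omega⟩ * y ⟨n + 1, by omega⟩ ∧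
        0 ≤ y ⟨0, by omega⟩ ∧ 0 ≤ y ⟨n + 1, by omega⟩ := by
  constructor
  · intro hy
    have hcl : IsClosed {y : Fin (n + 2) → ℝ | 0 ≤ quadF ℝ (MatS0 n S) y ∧
        0 ≤ y ⟨0, by omega⟩ ∧ 0 ≤ y ⟨n + 1, by omega⟩} :=
      (isClosed_le continuous_const (continuous_quadF _)).inter
        ((isClosed_le continuous_const (continuous_apply _)).inter
          (isClosed_le continuous_const (continuous_apply _)))
    obtain ⟨h1, h2, h3⟩ := closure_minimal (fun z (hz : z ∈ PosCone n S) =>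
      And.intro hz.1.le (And.intro hz.2.le (pos_last_of_mem_PosCone hpos hz).le)) hcl hy
    rw [quadF_MatS0 two_ne_zero] at h1
    exact ⟨by linarith, h2, h3⟩
  · rintro ⟨h1, h2, h3⟩
    set u : Fin (n + 2) → ℝ := Pi.single ⟨0, by omega⟩ 1 + Pi.single ⟨n + 1, by omega⟩ 1 with hu
    have hu0 : u ⟨0, by omega⟩ = 1 := by simp [hu]
    have hu1 : u ⟨n + 1, by omega⟩ = 1 := by simp [hu]
    have hum : vmid u = 0 := by
      ext i
      simp [hu, vmid, fin_val_ne]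
    have hlim : Filter.Tendsto (fun s : ℝ => y + s • u) (nhdsWithin 0 (Set.Ioi 0)) (nhds y) := by
      have : Filter.Tendsto (fun s : ℝ => y + s • u) (nhds 0) (nhds (y + (0 : ℝ) • u)) :=
        Continuous.tendsto (by fun_prop) 0
      rw [zero_smul, add_zero] at this
      exact this.mono_left nhdsWithin_le_nhds
    refine mem_closure_of_tendsto hlim (Filter.eventually_of_mem self_mem_nhdsWithin ?_)
    intro s hs
    have hs : 0 < s := hs
    have hm : vmid (y + s • u) = vmid y := by
      have : vmid (y + s • u) = vmid y + s • vmid u := rfl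
      rw [this, hum, smul_zero, add_zero]
    refine ⟨?_, ?_⟩
    · rw [quadF_MatS0 two_ne_zero, hm]
      simp only [Pi.add_apply, Pi.smul_apply, smul_eq_mul, hu0, hu1]
      nlinarith [mul_nonneg hs.le h2, mul_nonneg hs.le h3, mul_pos hs hs]
    · simp only [Pi.add_apply, Pi.smul_apply, smul_eq_mul, hu0]
      linarith

end Cone

section Asm

variable {n : ℕ} {S : Matrix (Fin n) (Fin n) ℤ} (l m : ℚ) (μ : Fin n → ℚ)

lemma asmVec_first : asmVec n l μ m ⟨0, by omega⟩ = l := by simp [asmVec]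

lemma asmVec_last : asmVec n l μ m ⟨n + 1, by omega⟩ = m := by simp [asmVec]

lemma vmid_asmVec : vmid (asmVec n l μ m) = μ := by
  ext i
  simp [asmVec, vmid, fin_val_ne]

lemma asmVec_eta (x : Fin (n + 2) → ℚ) :
    asmVec n (x ⟨0, by omega⟩) (vmid x) (x ⟨n + 1, by omega⟩) = x := by
  ext i
  rcases fin_add_two_cases i with rfl | rfl | ⟨i, rfl⟩ <;> simp [asmVec, vmid, fin_val_ne]

lemma asmVec_div (c : ℚ) :
    (fun i => asmVec n l μ m i / c) = asmVec n (l / c) (fun i => μ i / c) (m / c) := by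
  ext i
  rcases fin_add_two_cases i with rfl | rfl | ⟨i, rfl⟩ <;> simp [asmVec, fin_val_ne]

lemma inDual_asmVec :
    inDual (MatS0 n S) (asmVec n l μ m) ↔
      (∃ z : ℤ, l = z) ∧ inDual S μ ∧ ∃ z : ℤ, m = z := by
  have hmid : ∀ i : Fin n, ((MatS0 n S).map (Int.cast : ℤ → ℚ)).mulVec (asmVec n l μ m)
      ⟨(i : ℕ) + 1, by have := i.isLt; omega⟩ = -(S.map (Int.cast : ℤ → ℚ)).mulVec μ i := by
    intro i
    rw [MatS0, hyp_mulVec_mid, vmid_asmVec]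
    have : (-S).map (Int.cast : ℤ → ℚ) = -(S.map Int.cast) := by ext; simp
    rw [this, neg_mulVec, Pi.neg_apply]
  have hfst : ((MatS0 n S).map (Int.cast : ℤ → ℚ)).mulVec (asmVec n l μ m) ⟨0, by omega⟩ = m :=
    (hyp_mulVec_first (-S) _).trans (asmVec_last l m μ)
  have hlst : ((MatS0 n S).map (Int.cast : ℤ → ℚ)).mulVec (asmVec n l μ m) ⟨n + 1, by omega⟩ = l :=
    (hyp_mulVec_last (-S) _).trans (asmVec_first l m μ)
  constructor
  · intro h
    refine ⟨hlst ▸ h ⟨n + 1, by omega⟩, fun i => ?_, hfst ▸ h ⟨0, by omega⟩⟩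
    obtain ⟨z, hz⟩ := h ⟨(i : ℕ) + 1, by have := i.isLt; omega⟩
    rw [hmid] at hz
    exact ⟨-z, by push_cast; rw [← hz, neg_neg]⟩
  · rintro ⟨h0, h1, h2⟩ i
    rcases fin_add_two_cases i with rfl | rfl | ⟨i, rfl⟩
    · rwa [hfst]
    · rwa [hlst]
    · obtain ⟨z, hz⟩ := h1 i
      exact ⟨-z, by rw [hmid, hz]; push_cast; rfl⟩

lemma asmVec_mem_closure_iff (hpos : ∀ v : Fin n → ℝ, v ≠ 0 → 0 < bilin ℝ S v v) :
    (fun i => ((asmVec n l μ m i : ℚ) : ℝ)) ∈ closure (PosCone n S) ↔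
      bilin ℝ S (fun i => (μ i : ℝ)) (fun i => (μ i : ℝ)) / 2 ≤ l * m ∧ 0 ≤ l ∧ 0 ≤ m := by
  rw [mem_closure_PosCone_iff hpos]
  have : vmid (fun i => ((asmVec n l μ m i : ℚ) : ℝ)) = fun i => (μ i : ℝ) := by
    ext i
    simp [asmVec, vmid, fin_val_ne]
  rw [this]
  simp only [asmVec_first, asmVec_last]
  norm_cast

end Asm

section Gcd

variable {N : ℕ} {A : Matrix (Fin N) (Fin N) ℤ}

lemma inDual_div {x : Fin N → ℚ} {d : ℚ} :
    inDual A (fun i => x i / d) ↔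
      ∀ i, ∃ z : ℤ, (A.map (Int.cast : ℤ → ℚ)).mulVec x i / d = z := by
  have : (fun i => x i / d) = d⁻¹ • x := by ext i; simp [div_eq_inv_mul]
  rw [inDual, this, mulVec_smul]
  simp [div_eq_inv_mul]

lemma inDual_of_inDual_div {x : Fin N → ℚ} {c : ℚ} (z : ℤ) (hz : (z : ℚ) ≠ 0)
    (h : inDual A (fun i => x i / (z * c))) : inDual A (fun i => x i / c) := by
  rw [inDual_div] at h ⊢
  intro i
  obtain ⟨y, hy⟩ := h i
  refine ⟨z * y, ?_⟩
  push_cast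
  rw [← hy]
  field_simp

lemma dvd_ratGcd_iff {x : Fin N → ℚ} (hx : inDual A x) {d : ℕ} (hd : d ≠ 0) :
    d ∣ ratGcd ((A.map (Int.cast : ℤ → ℚ)).mulVec x) ↔ inDual A (fun i => x i / d) := by
  rw [ratGcd, Finset.dvd_gcd_iff, inDual_div]
  have hd' : (d : ℚ) ≠ 0 := by exact_mod_cast hd
  simp only [Finset.mem_univ, true_imp_iff]
  refine forall_congr' fun i => ?_
  obtain ⟨z, hz⟩ := hx i
  rw [hz, Rat.num_intCast, ← Int.natCast_dvd]
  constructor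
  · rintro ⟨y, rfl⟩
    exact ⟨y, by push_cast; field_simp⟩
  · rintro ⟨y, hy⟩
    refine ⟨y, ?_⟩
    rw [div_eq_iff hd'] at hy
    rw [mul_comm]
    exact_mod_cast hy

lemma mem_divisors_ratGcd
    (hnd : ∀ x : Fin N → ℚ, (A.map (Int.cast : ℤ → ℚ)).mulVec x = 0 → x = 0)
    {x : Fin N → ℚ} (hx : inDual A x) (h0 : x ≠ 0) {d : ℕ} :
    d ∈ (ratGcd ((A.map (Int.cast : ℤ → ℚ)).mulVec x)).divisors ↔
      d ≠ 0 ∧ inDual A (fun i => x i / d) := by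
  have hg : ratGcd ((A.map (Int.cast : ℤ → ℚ)).mulVec x) ≠ 0 := by
    intro h
    refine h0 (hnd x (funext fun i => ?_))
    rw [ratGcd, Finset.gcd_eq_zero_iff] at h
    simpa using h i (Finset.mem_univ i)
  rw [Nat.mem_divisors]
  constructor
  · rintro ⟨h, -⟩
    have hd : d ≠ 0 := by
      rintro rfl
      exact hg (zero_dvd_iff.1 h)
    exact ⟨hd, (dvd_ratGcd_iff hx hd).1 h⟩
  · rintro ⟨hd, h⟩
    exact ⟨(dvd_ratGcd_iff hx hd).2 h, hg⟩

end Gcd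

section Maass

variable {n : ℕ} {S : Matrix (Fin n) (Fin n) ℤ}

variable (S) in
/-- The right-hand side of the Maaß condition. -/
noncomputable def maassSum (k : ℤ) (a : (Fin (n + 2) → ℚ) → ℂ) (lam : Fin (n + 2) → ℚ) : ℂ :=
  ∑ d ∈ (ratGcd (((MatS0 n S).map (Int.cast : ℤ → ℚ)).mulVec lam)).divisors,
    ((d : ℂ)) ^ (k - 1) *
      a (asmVec n (lam ⟨0, by omega⟩ * lam ⟨n + 1, by omega⟩ / (d : ℚ) ^ 2)
        (fun i => vmid lam i / d) 1)

lemma maassSum_asmVec (k : ℤ) (a : (Fin (n + 2) → ℚ) → ℂ) (l m : ℚ) (μ : Fin n → ℚ) :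
    maassSum S k a (asmVec n l μ m)
      = ∑ d ∈ (ratGcd (((MatS0 n S).map (Int.cast : ℤ → ℚ)).mulVec (asmVec n l μ m))).divisors,
          ((d : ℂ)) ^ (k - 1) * a (asmVec n (l * m / (d : ℚ) ^ 2) (fun i => μ i / d) 1) := by
  simp only [maassSum, asmVec_first, asmVec_last, vmid_asmVec]

lemma asmVec_ne_zero {l m : ℚ} {μ : Fin n → ℚ} (hm : m ≠ 0) : asmVec n l μ m ≠ 0 := fun h =>
  hm (by rw [← asmVec_last l m μ, h]; rfl)

lemma intCast_div_natCast_iff (z : ℤ) {d : ℕ} (hd : d ≠ 0) :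
    (∃ y : ℤ, (z : ℚ) / d = y) ↔ (d : ℤ) ∣ z := by
  have hd' : (d : ℚ) ≠ 0 := by exact_mod_cast hd
  constructor
  · rintro ⟨y, hy⟩
    rw [div_eq_iff hd'] at hy
    exact ⟨y, by rw [mul_comm]; exact_mod_cast hy⟩
  · rintro ⟨y, rfl⟩
    exact ⟨y, by push_cast; field_simp⟩

open scoped Classical in
/-- The Hecke-type recursion satisfied by the right-hand side of the Maaß condition. -/
lemma maassSum_prime_pow_mul
    (hnd : ∀ x : Fin (n + 2) → ℚ, ((MatS0 n S).map (Int.cast : ℤ → ℚ)).mulVec x = 0 → x = 0)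
    (k : ℤ) (a : (Fin (n + 2) → ℚ) → ℂ) {p t : ℕ} (hp : p.Prime) (ht : 1 ≤ t)
    (l : ℤ) (μ : Fin n → ℚ) {m : ℤ} (hm : ¬ (p : ℤ) ∣ m) (hμ : inDual S μ) :
    maassSum S k a (asmVec n l μ ((p : ℚ) ^ t * m))
      = maassSum S k a (asmVec n ((p : ℚ) ^ t * l) μ m)
        + (p : ℂ) ^ (k - 1) *
          if inDual (MatS0 n S) (asmVec n (l / p) (fun i => μ i / p) ((p : ℚ) ^ (t - 1) * m)) then
            maassSum S k a (asmVec n (l / p) (fun i => μ i / p) ((p : ℚ) ^ (t - 1) * m))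
          else 0 := by
  have hp0 : (p : ℚ) ≠ 0 := by exact_mod_cast hp.ne_zero
  have hm0 : (m : ℚ) ≠ 0 := by
    rintro h
    exact hm (by rw [Int.cast_eq_zero.1 h]; exact dvd_zero _)
  obtain ⟨s, rfl⟩ : ∃ s, t = s + 1 := ⟨t - 1, by omega⟩
  have hx : inDual (MatS0 n S) (asmVec n l μ ((p : ℚ) ^ (s + 1) * m)) :=
    (inDual_asmVec ..).2 ⟨⟨l, rfl⟩, hμ, ⟨p ^ (s + 1) * m, by push_cast; rfl⟩⟩
  have hx' : inDual (MatS0 n S) (asmVec n ((p : ℚ) ^ (s + 1) * l) μ m) :=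
    (inDual_asmVec ..).2 ⟨⟨p ^ (s + 1) * l, by push_cast; rfl⟩, hμ, ⟨m, rfl⟩⟩
  have hdiv := fun d => mem_divisors_ratGcd (d := d) hnd hx
    (asmVec_ne_zero (mul_ne_zero (pow_ne_zero _ hp0) hm0))
  have hdiv' := fun d => mem_divisors_ratGcd (d := d) hnd hx' (asmVec_ne_zero hm0)
  have hpx : asmVec n (l / p) (fun i => μ i / p) ((p : ℚ) ^ (s + 1 - 1) * m)
      = fun i => asmVec n l μ ((p : ℚ) ^ (s + 1) * m) i / p := by
    rw [asmVec_div]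
    congr 1
    rw [Nat.add_sub_cancel, pow_succ]
    field_simp
  rw [maassSum_asmVec, ← Finset.sum_filter_not_add_sum_filter _ (fun d => p ∣ d)]
  congr 1
  · rw [maassSum_asmVec]
    refine Finset.sum_congr ?_ fun d _ => by
      rw [show (l : ℚ) * ((p : ℚ) ^ (s + 1) * m) = (p : ℚ) ^ (s + 1) * l * m by ring]
    ext d
    rw [Finset.mem_filter, hdiv, hdiv', asmVec_div, asmVec_div, inDual_asmVec, inDual_asmVec,
      and_assoc, and_congr_right_iff]
    intro hd
    rw [show (p : ℚ) ^ (s + 1) * (m : ℚ) = ((p ^ (s + 1) * m : ℤ) : ℚ) by push_cast; rfl,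
      show (p : ℚ) ^ (s + 1) * (l : ℚ) = ((p ^ (s + 1) * l : ℤ) : ℚ) by push_cast; rfl]
    simp only [intCast_div_natCast_iff _ hd]
    constructor
    · rintro ⟨⟨h1, h2, h3⟩, h4⟩
      have hcop : IsCoprime (d : ℤ) ((p : ℤ) ^ (s + 1)) :=
        (Nat.isCoprime_iff_coprime.2 ((hp.coprime_iff_not_dvd.2 h4).symm)).pow_right
      exact ⟨h1.mul_left _, h2, hcop.dvd_of_dvd_mul_left h3⟩
    · rintro ⟨h1, h2, h3⟩
      have h4 : ¬ p ∣ d := fun h => hm ((Int.natCast_dvd_natCast.2 h).trans h3)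
      have hcop : IsCoprime (d : ℤ) ((p : ℤ) ^ (s + 1)) :=
        (Nat.isCoprime_iff_coprime.2 ((hp.coprime_iff_not_dvd.2 h4).symm)).pow_right
      exact ⟨⟨hcop.dvd_of_dvd_mul_left h1, h2, h3.mul_left _⟩, h4⟩
  · split_ifs with h
    · have hdiv'' := fun d => mem_divisors_ratGcd (d := d) hnd h
        (asmVec_ne_zero (mul_ne_zero (pow_ne_zero _ hp0) hm0))
      rw [maassSum_asmVec, Finset.mul_sum]
      symm
      have hiff : ∀ d : ℕ, inDual (MatS0 n S) (fun i =>
            asmVec n (l / p) (fun i => μ i / p) ((p : ℚ) ^ (s + 1 - 1) * m) i / d) ↔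
          inDual (MatS0 n S) (fun i => asmVec n l μ ((p : ℚ) ^ (s + 1) * m) i / (p * d : ℕ)) := by
        intro d
        rw [hpx]
        simp only [div_div, Nat.cast_mul]
      refine Finset.sum_bij (fun d _ => p * d) ?_ ?_ ?_ ?_
      · intro d hd
        rw [hdiv'', hiff] at hd
        rw [Finset.mem_filter, hdiv]
        exact ⟨⟨mul_ne_zero hp.ne_zero hd.1, hd.2⟩, dvd_mul_right _ _⟩
      · intro d _ d' _ hdd
        exact Nat.eq_of_mul_eq_mul_left hp.pos hdd
      · intro d hd
        rw [Finset.mem_filter, hdiv] at hd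
        obtain ⟨⟨h0, h1⟩, d, rfl⟩ := hd
        exact ⟨d, by rw [hdiv'', hiff]; exact ⟨right_ne_zero_of_mul h0, h1⟩, rfl⟩
      · intro d hd
        rw [hdiv''] at hd
        have hd0 : (d : ℚ) ≠ 0 := by exact_mod_cast hd.1
        rw [← mul_assoc, ← mul_zpow, Nat.cast_mul]
        congr 3
        · rw [Nat.add_sub_cancel, pow_succ]
          push_cast
          field_simp
          ring
        · ext i
          rw [Nat.cast_mul, div_div]
    · rw [mul_zero]
      refine Finset.sum_eq_zero fun d hd => ?_
      rw [Finset.mem_filter, hdiv] at hd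
      obtain ⟨⟨h0, h1⟩, d, rfl⟩ := hd
      refine absurd ?_ h
      rw [hpx]
      refine inDual_of_inDual_div (d : ℤ) (by exact_mod_cast right_ne_zero_of_mul h0) ?_
      simpa [mul_comm] using h1

end Maass

section Translation

variable {n : ℕ} {S : Matrix (Fin n) (Fin n) ℤ} {q k : ℤ} {f : (Fin (n + 2) → ℂ) → ℂ}
  {a : (Fin (n + 2) → ℚ) → ℂ}

/-- The vector `(0, v, 0)`. -/
def zeroPad (v : Fin n → ℤ) : Fin (n + 2) → ℤ := fun i =>
  if h0 : (i : ℕ) = 0 then 0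
  else if h1 : (i : ℕ) = n + 1 then 0
  else v ⟨(i : ℕ) - 1, by have := i.isLt; omega⟩

section Cast

variable (K : Type) [Field K] (v : Fin n → ℤ)

lemma zeroPad_zero : zeroPad v 0 = 0 := by simp [zeroPad]

lemma zeroPad_last : zeroPad v ⟨n + 1, by omega⟩ = 0 := by simp [zeroPad]

lemma vmid_zeroPad : vmid (fun i => (zeroPad v i : K)) = fun i => (v i : K) := by
  ext i
  simp [zeroPad, vmid, fin_val_ne]

lemma vmid_single_first (c : ℤ) :
    vmid (fun i => ((Pi.single ⟨0, by omega⟩ c : Fin (n + 2) → ℤ) i : K)) = 0 := by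
  ext i
  simp [vmid]

lemma vmid_single_last (c : ℤ) :
    vmid (fun i => ((Pi.single ⟨n + 1, by omega⟩ c : Fin (n + 2) → ℤ) i : K)) = 0 := by
  ext i
  simp [vmid, fin_val_ne]

end Cast

lemma bilin_zero_left {m : ℕ} {K : Type} [Field K] (A : Matrix (Fin m) (Fin m) ℤ)
    (x : Fin m → K) : bilin K A 0 x = 0 := by
  simp [bilin]

lemma bilin_zero_right {m : ℕ} {K : Type} [Field K] (A : Matrix (Fin m) (Fin m) ℤ)
    (x : Fin m → K) : bilin K A x 0 = 0 := by
  simp [bilin]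

lemma one_zero_one_mem_PosCone :
    (fun i => ((asmVec n 1 0 1 i : ℚ) : ℝ)) ∈ PosCone n S := by
  refine ⟨?_, by simp [asmVec]⟩
  have : vmid (fun i => ((asmVec n 1 0 1 i : ℚ) : ℝ)) = 0 := by
    ext i
    simp [asmVec, vmid, fin_val_ne]
  rw [quadF_MatS0 two_ne_zero, this, bilin_zero_left]
  simp [asmVec]

lemma quadF_eichler {m : ℕ} {A : Matrix (Fin m) (Fin m) ℤ} {e w : Fin m → ℤ} {q : ℤ}
    (hA : A.IsSymm) (hee : e ⬝ᵥ A.mulVec e = 0) (hew : e ⬝ᵥ A.mulVec w = 0)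
    (hww : w ⬝ᵥ A.mulVec w = 2 * q) (y : Fin m → ℝ) :
    quadF ℝ A (eichler A (fun i => (e i : ℝ)) (fun i => (w i : ℝ)) (q : ℝ) y) = quadF ℝ A y := by
  rw [quadF, bilin_eichler hA, quadF]
  · rw [bilin_intCast, hee, Int.cast_zero]
  · rw [bilin_intCast, hew, Int.cast_zero]
  · rw [bilin_intCast, hww]
    push_cast
    rfl

lemma zeroPad_dotProduct {v : Fin n → ℤ} (hv : v ⬝ᵥ S.mulVec v = 2 * q) :
    zeroPad v ⬝ᵥ (MatS0 n S).mulVec (zeroPad v) = 2 * -q := by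
  apply Int.cast_injective (α := ℚ)
  rw [← bilin_intCast, bilin_MatS0, vmid_zeroPad, bilin_intCast, hv]
  simp [zeroPad_zero]

lemma coeff_translate_zero
    (hS : S.IsSymm)
    (hnd : ∀ x : Fin (n + 2) → ℚ, ((MatS0 n S).map (Int.cast : ℤ → ℚ)).mulVec x = 0 → x = 0)
    (hvan : ∀ lam : Fin (n + 2) → ℚ,
      ¬(inDual (MatS0 n S) lam ∧
          (fun i => ((lam i : ℚ) : ℝ)) ∈ closure (PosCone n S)) → a lam = 0)
    (hsum : ∀ z ∈ HS n S,
      HasSum (fun lam : {lam : Fin (n + 2) → ℚ //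
          inDual (MatS0 n S) lam ∧
            (fun i => ((lam i : ℚ) : ℝ)) ∈ closure (PosCone n S)} =>
        a lam.1 * Complex.exp (2 * Real.pi * Complex.I *
          bilin ℂ (MatS0 n S) (fun i => ((lam.1 i : ℚ) : ℂ)) z)) (f z))
    (hmod : ∀ M ∈ GammaTilde n S, ∀ z ∈ HS n S,
      f (actM n S M z) = (jayM n S M z) ^ k * f z)
    {v : Fin n → ℤ} (hv : v ⬝ᵥ S.mulVec v = 2 * q) (l : ℤ) :
    a (asmVec n l (fun i => l * v i) (l * q)) = a (asmVec n l 0 0) := by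
  set e : Fin (n + 2) → ℤ := Pi.single ⟨n + 1, by omega⟩ 1 with he
  have hee : e ⬝ᵥ (MatS0 n S).mulVec e = 0 := by
    apply Int.cast_injective (α := ℚ)
    rw [← bilin_intCast, bilin_MatS0, he, vmid_single_last, bilin_zero_left]
    simp
  have hew : e ⬝ᵥ (MatS0 n S).mulVec (zeroPad v) = 0 := by
    apply Int.cast_injective (α := ℚ)
    rw [← bilin_intCast, bilin_MatS0, he, vmid_single_last, bilin_zero_left]
    simp [zeroPad_zero]
  have hww := zeroPad_dotProduct hv
  have h := coeff_eichler (q := -q) hS hnd hvan hsum hmod hee hew hww (fun y hy => ⟨by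
      rw [quadF_eichler (MatS0_isSymm hS) hee hew hww]
      exact hy.1, by
      simpa [eichler, zeroPad_zero, he] using hy.2⟩) one_zero_one_mem_PosCone
    (lam := asmVec n l 0 0)
    ((inDual_asmVec ..).2 ⟨⟨l, rfl⟩, fun i => ⟨0, by simp⟩, ⟨0, by simp⟩⟩)
  rw [← h]
  congr 1
  have h1 : bilin ℚ (MatS0 n S) (fun i => (e i : ℚ)) (asmVec n l 0 0) = l := by
    rw [bilin_MatS0, he, vmid_single_last, bilin_zero_left, asmVec_first]
    simp
  have h2 : bilin ℚ (MatS0 n S) (fun i => (zeroPad v i : ℚ)) (asmVec n l 0 0) = 0 := by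
    rw [bilin_MatS0, vmid_asmVec, bilin_zero_right]
    simp [zeroPad_zero, zeroPad_last]
  rw [eichler, h1, h2]
  ext i
  rcases fin_add_two_cases i with rfl | rfl | ⟨i, rfl⟩
  · simp [asmVec, zeroPad, he]
  · simp [asmVec, zeroPad, he]
    ring
  · simp [asmVec, zeroPad, he, fin_val_ne]

lemma coeff_translate_one
    (hS : S.IsSymm) (hpos : ∀ v : Fin n → ℝ, v ≠ 0 → 0 < bilin ℝ S v v)
    (hnd : ∀ x : Fin (n + 2) → ℚ, ((MatS0 n S).map (Int.cast : ℤ → ℚ)).mulVec x = 0 → x = 0)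
    (hvan : ∀ lam : Fin (n + 2) → ℚ,
      ¬(inDual (MatS0 n S) lam ∧
          (fun i => ((lam i : ℚ) : ℝ)) ∈ closure (PosCone n S)) → a lam = 0)
    (hsum : ∀ z ∈ HS n S,
      HasSum (fun lam : {lam : Fin (n + 2) → ℚ //
          inDual (MatS0 n S) lam ∧
            (fun i => ((lam i : ℚ) : ℝ)) ∈ closure (PosCone n S)} =>
        a lam.1 * Complex.exp (2 * Real.pi * Complex.I *
          bilin ℂ (MatS0 n S) (fun i => ((lam.1 i : ℚ) : ℂ)) z)) (f z))
    (hmod : ∀ M ∈ GammaTilde n S, ∀ z ∈ HS n S,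
      f (actM n S M z) = (jayM n S M z) ^ k * f z)
    {v : Fin n → ℤ} (hv : v ⬝ᵥ S.mulVec v = 2 * q) :
    a (asmVec n q (fun i => v i) 1) = a (asmVec n 0 0 1) := by
  set e : Fin (n + 2) → ℤ := Pi.single ⟨0, by omega⟩ 1 with he
  have hee : e ⬝ᵥ (MatS0 n S).mulVec e = 0 := by
    apply Int.cast_injective (α := ℚ)
    rw [← bilin_intCast, bilin_MatS0, he, vmid_single_first, bilin_zero_left]
    simp
  have hew : e ⬝ᵥ (MatS0 n S).mulVec (zeroPad v) = 0 := by
    apply Int.cast_injective (α := ℚ)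
    rw [← bilin_intCast, bilin_MatS0, he, vmid_single_first, bilin_zero_left]
    simp [zeroPad_last]
  have hww := zeroPad_dotProduct hv
  have h := coeff_eichler (q := -q) hS hnd hvan hsum hmod hee hew hww (fun y hy =>
      mem_PosCone_of_pos_last hpos (by
        rw [quadF_eichler (MatS0_isSymm hS) hee hew hww]
        exact hy.1) (by
        simpa [eichler, zeroPad_last, he] using pos_last_of_mem_PosCone hpos hy))
    one_zero_one_mem_PosCone (lam := asmVec n 0 0 1)
    ((inDual_asmVec ..).2 ⟨⟨0, by simp⟩, fun i => ⟨0, by simp⟩, ⟨1, by simp⟩⟩)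
  rw [← h]
  congr 1
  have h1 : bilin ℚ (MatS0 n S) (fun i => (e i : ℚ)) (asmVec n 0 0 1) = 1 := by
    rw [bilin_MatS0, he, vmid_single_first, bilin_zero_left, asmVec_last]
    simp
  have h2 : bilin ℚ (MatS0 n S) (fun i => (zeroPad v i : ℚ)) (asmVec n 0 0 1) = 0 := by
    rw [bilin_MatS0, vmid_asmVec, bilin_zero_right]
    simp [zeroPad_zero, zeroPad_last]
  rw [eichler, h1, h2]
  ext i
  rcases fin_add_two_cases i with rfl | rfl | ⟨i, rfl⟩ <;>
    simp [asmVec, zeroPad, he, fin_val_ne]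

end Translation

section Main

variable {n : ℕ} {S : Matrix (Fin n) (Fin n) ℤ}

lemma MatS0_nondegenerate (hpos : ∀ v : Fin n → ℝ, v ≠ 0 → 0 < bilin ℝ S v v)
    (x : Fin (n + 2) → ℚ) (h : ((MatS0 n S).map (Int.cast : ℤ → ℚ)).mulVec x = 0) : x = 0 := by
  refine hyp_mulVec_injective (-S) x (fun v hv => ?_) h
  by_contra hv0
  have hvR : (fun i => (v i : ℝ)) ≠ 0 := fun h => hv0 (funext fun i => by
    simpa using congrFun h i)
  refine (hpos _ hvR).ne' ?_
  have h0 : bilin ℚ S v v = 0 := by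
    rw [← neg_eq_zero, ← bilin_neg, bilin, hv, dotProduct_zero]
  have h1 : bilin ℝ S (fun i => (v i : ℝ)) (fun i => (v i : ℝ)) = (bilin ℚ S v v : ℚ) := by
    simp [bilin, dotProduct, Matrix.mulVec]
  rw [h1, h0, Rat.cast_zero]

lemma asmVec_pow_mul_mem_closure (hpos : ∀ v : Fin n → ℝ, v ≠ 0 → 0 < bilin ℝ S v v)
    {c : ℚ} (hc : 0 < c) {l m : ℚ} {μ : Fin n → ℚ}
    (h : (fun i => ((asmVec n l μ (c * m) i : ℚ) : ℝ)) ∈ closure (PosCone n S)) :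
    (fun i => ((asmVec n (c * l) μ m i : ℚ) : ℝ)) ∈ closure (PosCone n S) := by
  rw [asmVec_mem_closure_iff _ _ _ hpos] at h ⊢
  obtain ⟨h1, h2, h3⟩ := h
  refine ⟨?_, mul_nonneg hc.le h2, nonneg_of_mul_nonneg_right h3 hc⟩
  push_cast at h1 ⊢
  linarith

lemma asmVec_div_mem_closure (hpos : ∀ v : Fin n → ℝ, v ≠ 0 → 0 < bilin ℝ S v v)
    {c : ℚ} (hc : 0 < c) {l m : ℚ} {μ : Fin n → ℚ}
    (h : (fun i => ((asmVec n l μ m i : ℚ) : ℝ)) ∈ closure (PosCone n S)) :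
    (fun i => ((asmVec n (l / c) (fun i => μ i / c) (m / c) i : ℚ) : ℝ)) ∈
      closure (PosCone n S) := by
  rw [asmVec_mem_closure_iff _ _ _ hpos] at h ⊢
  obtain ⟨h1, h2, h3⟩ := h
  refine ⟨?_, div_nonneg h2 hc.le, div_nonneg h3 hc.le⟩
  have : (fun i => ((μ i / c : ℚ) : ℝ)) = (c : ℝ)⁻¹ • fun i => (μ i : ℝ) := by
    ext i
    simp [div_eq_inv_mul]
  have hc' : (0 : ℝ) < c := by exact_mod_cast hc
  rw [this, bilin_smul_left, bilin_smul_right]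
  push_cast
  have := mul_le_mul_of_nonneg_left h1 (sq_nonneg ((c : ℝ)⁻¹))
  calc _ = ((c : ℝ)⁻¹) ^ 2 * (bilin ℝ S (fun i => (μ i : ℝ)) (fun i => (μ i : ℝ)) / 2) := by ring
    _ ≤ _ := this
    _ = _ := by field_simp

lemma prime_pow_mul_div {p t : ℕ} (hp : p.Prime) (ht : 1 ≤ t) (m : ℚ) :
    (p : ℚ) ^ (t - 1) * m = (p : ℚ) ^ t * m / p := by
  have hp0 : (p : ℚ) ≠ 0 := by exact_mod_cast hp.ne_zero
  obtain ⟨s, rfl⟩ : ∃ s, t = s + 1 := ⟨t - 1, by omega⟩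
  rw [Nat.add_sub_cancel, pow_succ]
  field_simp

lemma local_maass_of_maass (hpos : ∀ v : Fin n → ℝ, v ≠ 0 → 0 < bilin ℝ S v v) {k : ℤ}
    {a : (Fin (n + 2) → ℚ) → ℂ}
    (hvan : ∀ lam : Fin (n + 2) → ℚ,
      ¬(inDual (MatS0 n S) lam ∧
          (fun i => ((lam i : ℚ) : ℝ)) ∈ closure (PosCone n S)) → a lam = 0)
    (hmaass : ∀ lam : Fin (n + 2) → ℚ, inDual (MatS0 n S) lam →
      (fun i => ((lam i : ℚ) : ℝ)) ∈ closure (PosCone n S) → lam ≠ 0 → a lam = maassSum S k a lam)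
    {p t : ℕ} (hp : p.Prime) (ht : 1 ≤ t) {l : ℚ} {μ : Fin n → ℚ} {m : ℤ} (hm : ¬ (p : ℤ) ∣ m)
    (hdual : inDual (MatS0 n S) (asmVec n l μ ((p : ℚ) ^ t * m)))
    (hcl : (fun i => ((asmVec n l μ ((p : ℚ) ^ t * m) i : ℚ) : ℝ)) ∈ closure (PosCone n S)) :
    a (asmVec n l μ ((p : ℚ) ^ t * m))
      = a (asmVec n ((p : ℚ) ^ t * l) μ (m : ℚ))
        + (p : ℂ) ^ (k - 1) *
          a (asmVec n (l / p) (fun i => μ i / p) ((p : ℚ) ^ (t - 1) * m)) := by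
  have hp0 : (0 : ℚ) < p := by exact_mod_cast hp.pos
  have hm0 : (m : ℚ) ≠ 0 := by
    rintro h
    exact hm (by rw [Int.cast_eq_zero.1 h]; exact dvd_zero _)
  obtain ⟨⟨l, rfl⟩, hμ, -⟩ := (inDual_asmVec ..).1 hdual
  rw [hmaass _ hdual hcl (asmVec_ne_zero (mul_ne_zero (pow_ne_zero _ hp0.ne') hm0)),
    maassSum_prime_pow_mul (MatS0_nondegenerate hpos) k a hp ht l μ hm hμ,
    hmaass (asmVec n ((p : ℚ) ^ t * l) μ m)
      ((inDual_asmVec ..).2 ⟨⟨p ^ t * l, by push_cast; rfl⟩, hμ, ⟨m, rfl⟩⟩)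
      (asmVec_pow_mul_mem_closure hpos (pow_pos hp0 t) hcl) (asmVec_ne_zero hm0)]
  congr 2
  split_ifs with h
  · refine (hmaass _ h ?_ (asmVec_ne_zero (mul_ne_zero (pow_ne_zero _ hp0.ne') hm0))).symm
    rw [prime_pow_mul_div hp ht]
    exact asmVec_div_mem_closure hpos hp0 hcl
  · exact (hvan _ fun h' => h h'.1).symm

lemma maass_of_local_maass_of_pos (hpos : ∀ v : Fin n → ℝ, v ≠ 0 → 0 < bilin ℝ S v v) {k : ℤ}
    {a : (Fin (n + 2) → ℚ) → ℂ}
    (hvan : ∀ lam : Fin (n + 2) → ℚ,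
      ¬(inDual (MatS0 n S) lam ∧
          (fun i => ((lam i : ℚ) : ℝ)) ∈ closure (PosCone n S)) → a lam = 0)
    (hloc : ∀ p : ℕ, p.Prime → ∀ t : ℕ, 1 ≤ t →
      ∀ (l : ℚ) (μ : Fin n → ℚ) (m : ℤ), ¬ (p : ℤ) ∣ m →
      inDual (MatS0 n S) (asmVec n l μ ((p : ℚ) ^ t * m)) →
      (fun i => ((asmVec n l μ ((p : ℚ) ^ t * m) i : ℚ) : ℝ)) ∈ closure (PosCone n S) →
      a (asmVec n l μ ((p : ℚ) ^ t * m))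
        = a (asmVec n ((p : ℚ) ^ t * l) μ (m : ℚ))
          + ((p : ℂ)) ^ (k - 1) *
            a (asmVec n (l / p) (fun i => μ i / p) ((p : ℚ) ^ (t - 1) * m)))
    {m : ℕ} (hm : m ≠ 0) (l : ℤ) {μ : Fin n → ℚ} (hμ : inDual S μ)
    (hcl : (fun i => ((asmVec n l μ m i : ℚ) : ℝ)) ∈ closure (PosCone n S)) :
    a (asmVec n l μ m) = maassSum S k a (asmVec n l μ m) := by
  have hnd := MatS0_nondegenerate hpos
  induction m using Nat.strong_induction_on generalizing l μ with
  | _ m ih =>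
  have hdual : inDual (MatS0 n S) (asmVec n l μ m) :=
    (inDual_asmVec ..).2 ⟨⟨l, rfl⟩, hμ, ⟨m, by push_cast; rfl⟩⟩
  by_cases h1 : m = 1
  · subst h1
    have hdiv : (ratGcd (((MatS0 n S).map (Int.cast : ℤ → ℚ)).mulVec
        (asmVec n l μ ((1 : ℕ) : ℚ)))).divisors = {1} := by
      ext d
      rw [mem_divisors_ratGcd hnd hdual (asmVec_ne_zero (by simp)), asmVec_div, inDual_asmVec,
        Finset.mem_singleton]
      constructor
      · rintro ⟨hd, -, -, h⟩
        have := (intCast_div_natCast_iff 1 hd).1 (by simpa using h)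
        exact Nat.dvd_one.1 (by exact_mod_cast this)
      · rintro rfl
        simp only [Nat.cast_one, div_one]
        exact ⟨one_ne_zero, ⟨l, rfl⟩, hμ, ⟨1, by simp⟩⟩
    rw [maassSum_asmVec, hdiv]
    simp
  · obtain ⟨p, hp, hpm⟩ := Nat.exists_prime_and_dvd h1
    obtain ⟨t, m', hm', rfl⟩ := Nat.exists_eq_pow_mul_and_not_dvd hm p hp.ne_one
    have ht : 1 ≤ t := by
      rcases t with _ | t
      · exact absurd (by simpa using hpm) hm'
      · omega
    have hp0 : (0 : ℚ) < p := by exact_mod_cast hp.pos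
    have hm0 : m' ≠ 0 := right_ne_zero_of_mul hm
    have hcast : ((p ^ t * m' : ℕ) : ℚ) = (p : ℚ) ^ t * (m' : ℤ) := by push_cast; rfl
    have hm'' : ¬ (p : ℤ) ∣ (m' : ℤ) := by exact_mod_cast hm'
    have hlt : m' < p ^ t * m' :=
      lt_mul_of_one_lt_left (Nat.pos_of_ne_zero hm0) (Nat.one_lt_pow (by omega) hp.one_lt)
    rw [hcast] at hcl hdual ⊢
    rw [hloc p hp t ht l μ m' hm'' hdual hcl, maassSum_prime_pow_mul hnd k a hp ht l μ hm'' hμ]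
    have hcl' := asmVec_pow_mul_mem_closure hpos (pow_pos hp0 t) hcl
    have e1 := ih m' hlt hm0 (p ^ t * l) hμ (by push_cast at hcl' ⊢; exact hcl')
    push_cast at e1 ⊢
    rw [e1]
    congr 2
    split_ifs with h
    · obtain ⟨⟨y, hy⟩, hμ', -⟩ := (inDual_asmVec ..).1 h
      have hlt' : p ^ (t - 1) * m' < p ^ t * m' :=
        Nat.mul_lt_mul_of_pos_right (Nat.pow_lt_pow_right hp.one_lt (by omega))
          (Nat.pos_of_ne_zero hm0)
      have e2 := ih _ hlt' (mul_ne_zero (pow_ne_zero _ hp.ne_zero) hm0) y hμ' (by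
        have := asmVec_div_mem_closure hpos hp0 hcl
        rw [← prime_pow_mul_div hp ht, hy] at this
        push_cast at this ⊢
        exact this)
      rw [← hy] at e2
      push_cast at e2
      exact e2
    · exact hvan _ fun h' => h h'.1

lemma maassSum_zero_zero
    (hnd : ∀ x : Fin (n + 2) → ℚ, ((MatS0 n S).map (Int.cast : ℤ → ℚ)).mulVec x = 0 → x = 0)
    (k : ℤ) {a : (Fin (n + 2) → ℚ) → ℂ} {v : Fin n → ℤ} {q : ℤ}
    (htrans : ∀ c : ℤ, a (asmVec n (c ^ 2 * q : ℤ) (fun i => (c * v i : ℤ)) 1) = a (asmVec n 0 0 1))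
    {l : ℤ} (hl : l ≠ 0) (hq : q ≠ 0) :
    maassSum S k a (asmVec n l (fun i => l * v i) (l * q)) = maassSum S k a (asmVec n l 0 0) := by
  have hlQ : (l : ℚ) ≠ 0 := by exact_mod_cast hl
  have hqQ : (q : ℚ) ≠ 0 := by exact_mod_cast hq
  have hlat : ∀ w : Fin n → ℤ, inDual S (fun i => (w i : ℚ)) := fun w i =>
    ⟨S.mulVec w i, by simp [Matrix.mulVec, dotProduct]⟩
  have h0 : inDual (MatS0 n S) (asmVec n l 0 0) :=
    (inDual_asmVec ..).2 ⟨⟨l, rfl⟩, fun i => ⟨0, by simp⟩, ⟨0, by simp⟩⟩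
  have h0' : asmVec n l 0 0 ≠ 0 := fun h => hlQ (by rw [← asmVec_first l 0 (0 : Fin n → ℚ), h]; rfl)
  have h1 : inDual (MatS0 n S) (asmVec n l (fun i => l * v i) (l * q)) :=
    (inDual_asmVec ..).2 ⟨⟨l, rfl⟩, by simpa using hlat fun i => l * v i,
      ⟨l * q, by push_cast; rfl⟩⟩
  have hd0 : ∀ d, d ∈ (ratGcd (((MatS0 n S).map (Int.cast : ℤ → ℚ)).mulVec
      (asmVec n l 0 0))).divisors ↔ d ≠ 0 ∧ ∃ z : ℤ, (l : ℚ) / d = z := by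
    intro d
    rw [mem_divisors_ratGcd hnd h0 h0', asmVec_div, inDual_asmVec]
    refine and_congr_right fun _ => ⟨fun h => h.1, fun h => ⟨h, fun i => ⟨0, ?_⟩, ⟨0, by simp⟩⟩⟩
    simp [Matrix.mulVec, dotProduct]
  rw [maassSum_asmVec, maassSum_asmVec]
  refine Finset.sum_congr ?_ fun d hd => ?_
  · ext d
    rw [hd0, mem_divisors_ratGcd hnd h1 (asmVec_ne_zero (mul_ne_zero hlQ hqQ)), asmVec_div,
      inDual_asmVec]
    refine and_congr_right fun _ => ⟨fun h => h.1, ?_⟩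
    rintro ⟨z, hz⟩
    refine ⟨⟨z, hz⟩, ?_, ⟨z * q, by push_cast; rw [← hz]; ring⟩⟩
    convert hlat fun i => z * v i using 2 with i
    push_cast
    rw [← hz]
    ring
  · obtain ⟨hd, z, hz⟩ := (hd0 d).1 hd
    congr 1
    convert htrans z using 2
    · push_cast
      rw [← hz]
      congr 1
      · field_simp
      · ext i
        field_simp
    · congr 1
      · simp
      · ext i
        simp

end Main

end OEis

open OEis

/-- for a modular form of weight `k` for the discriminant
kernel with Fourier coefficients `a`, the Maaß condition is equivalent to
the local Maaß condition at every prime. -/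
theorem maass_condition_iff_local_maass_condition
    (n : ℕ) (hn : 1 ≤ n) (S : Matrix (Fin n) (Fin n) ℤ)
    (hsymm : S.IsSymm)
    (hpos : ∀ v : Fin n → ℝ, v ≠ 0 → 0 < bilin ℝ S v v)
    (heven : ∀ v : Fin n → ℤ, 2 ∣ v ⬝ᵥ S.mulVec v)
    (k : ℤ)
    (f : (Fin (n + 2) → ℂ) → ℂ) (a : (Fin (n + 2) → ℚ) → ℂ)
    (hvan : ∀ lam : Fin (n + 2) → ℚ,
      ¬(inDual (MatS0 n S) lam ∧
          (fun i => ((lam i : ℚ) : ℝ)) ∈ closure (PosCone n S)) → a lam = 0)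
    (hsum : ∀ z ∈ HS n S,
      HasSum (fun lam : {lam : Fin (n + 2) → ℚ //
          inDual (MatS0 n S) lam ∧
            (fun i => ((lam i : ℚ) : ℝ)) ∈ closure (PosCone n S)} =>
        a lam.1 * Complex.exp (2 * Real.pi * Complex.I *
          bilin ℂ (MatS0 n S) (fun i => ((lam.1 i : ℚ) : ℂ)) z)) (f z))
    (hmod : ∀ M ∈ GammaTilde n S, ∀ z ∈ HS n S,
      f (actM n S M z) = (jayM n S M z) ^ k * f z) :
    (∀ lam : Fin (n + 2) → ℚ, inDual (MatS0 n S) lam →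
        (fun i => ((lam i : ℚ) : ℝ)) ∈ closure (PosCone n S) → lam ≠ 0 →
        a lam = ∑ d ∈ (ratGcd (((MatS0 n S).map (Int.cast : ℤ → ℚ)).mulVec lam)).divisors,
          ((d : ℂ)) ^ (k - 1) *
            a (asmVec n
                (lam ⟨0, by omega⟩ * lam ⟨n + 1, by omega⟩ / (d : ℚ) ^ 2)
                (fun i => vmid lam i / d) 1))
    ↔
    (∀ p : ℕ, p.Prime → ∀ t : ℕ, 1 ≤ t →
      ∀ (l : ℚ) (μ : Fin n → ℚ) (m : ℤ), ¬ (p : ℤ) ∣ m →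
      inDual (MatS0 n S) (asmVec n l μ ((p : ℚ) ^ t * m)) →
      (fun i => ((asmVec n l μ ((p : ℚ) ^ t * m) i : ℚ) : ℝ)) ∈ closure (PosCone n S) →
      a (asmVec n l μ ((p : ℚ) ^ t * m))
        = a (asmVec n ((p : ℚ) ^ t * l) μ (m : ℚ))
          + ((p : ℂ)) ^ (k - 1) *
            a (asmVec n (l / p) (fun i => μ i / p) ((p : ℚ) ^ (t - 1) * m))) := by
  have hnd := MatS0_nondegenerate hpos
  constructor
  · intro hmaass p hp t ht l μ m hm hdual hcl
    exact local_maass_of_maass hpos hvan hmaass hp ht hm hdual hcl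
  · intro hloc lam hdual hcl hlam
    change a lam = maassSum S k a lam
    obtain ⟨l, μ, m, rfl⟩ : ∃ l μ m, lam = asmVec n l μ m := ⟨_, _, _, (asmVec_eta lam).symm⟩
    obtain ⟨⟨l, rfl⟩, hμ, ⟨m, rfl⟩⟩ := (inDual_asmVec ..).1 hdual
    obtain ⟨hQ, hl, hm⟩ := (asmVec_mem_closure_iff _ _ _ hpos).1 hcl
    lift m to ℕ using by exact_mod_cast hm
    rcases eq_or_ne m 0 with rfl | hm0
    · obtain rfl : μ = 0 := by
        by_contra h
        have := hpos (fun i => (μ i : ℝ)) fun h' => h (funext fun i => by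
          simpa using congrFun h' i)
        simp only [Nat.cast_zero, Int.cast_zero, Rat.cast_zero, mul_zero] at hQ
        linarith
      have hl0 : l ≠ 0 := by
        rintro rfl
        refine hlam (funext fun i => ?_)
        simp [asmVec]
      set v : Fin n → ℤ := Pi.single ⟨0, hn⟩ 1 with hv
      obtain ⟨q, hq⟩ := heven v
      have hq0 : 0 < q := by
        have h := hpos (fun i => (v i : ℝ)) fun h' => by
          simpa [hv] using congrFun h' ⟨0, hn⟩
        rw [bilin_intCast, hq] at h
        have : 0 < 2 * q := by exact_mod_cast h
        omega
      have hsc : ∀ c : ℤ, (fun i => c * v i) ⬝ᵥ S.mulVec (fun i => c * v i) = 2 * (c ^ 2 * q) := by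
        intro c
        rw [show (fun i => c * v i) = c • v from rfl, mulVec_smul, smul_dotProduct,
          dotProduct_smul, hq]
        simp only [smul_eq_mul]
        ring
      rw [Int.natCast_zero, Int.cast_zero,
        ← maassSum_zero_zero hnd k (fun c =>
          coeff_translate_one hsymm hpos hnd hvan hsum hmod (hsc c)) hl0 hq0.ne',
        ← coeff_translate_zero hsymm hnd hvan hsum hmod hq l]
      lift q to ℕ using hq0.le
      lift l to ℕ using by exact_mod_cast hl
      have hlq : (((l : ℕ) : ℤ) : ℚ) * (((q : ℕ) : ℤ) : ℚ) = ((l * q : ℕ) : ℚ) := by push_cast; rfl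
      rw [hlq]
      refine maass_of_local_maass_of_pos hpos hvan hloc
        (mul_ne_zero (by exact_mod_cast hl0) (by exact_mod_cast hq0.ne')) _ ?_ ?_
      · intro i
        exact ⟨l * S.mulVec v i, by simp [Matrix.mulVec, dotProduct, Finset.mul_sum]; grind⟩
      · rw [asmVec_mem_closure_iff _ _ _ hpos]
        refine ⟨?_, hl, by positivity⟩
        have h2 := bilin_intCast (A := S) ℝ (fun i => l * v i) (fun i => l * v i)
        rw [hsc] at h2
        push_cast at h2 ⊢
        rw [h2]
        apply le_of_eq
        ring
    · exact maass_of_local_maass_of_pos hpos hvan hloc hm0 l hμ hcl
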